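/- arXiv:2204.02223 — 5 statements merged into one kernel-verified Lean document; each statement's English description precedes it below -/
import Mathlib

section
/- Let X be a complex Hilbert space and T a C₀-semigroup on X with sup_{t ≥ 0} ‖T(t)‖ ≤ K < ∞. Let R : {λ ∈ ℂ : Re λ ≥ 0} → L(X) satisfy the resolvent identity on {Re λ ≥ 0} and the Laplace-transform identity R(λ)x = ∫₀^∞ e^{−λt} T(t)x dt for Re λ > 0. Let M : [0,∞) → (0,∞) be continuous and non-decreasing with ‖R(iξ)‖ ≤ M(|ξ|) for all ξ ∈ ℝ, and assume M has positive increase: there exist α > 0, c ∈ (0,1] and s₀ > 0 such that M(λs)/M(s) ≥ c λ^α for all λ ≥ 1 and s ≥ s₀. Then there exist C ≥ 0 and t₀ ≥ 0 such that for every t ≥ t₀ and every r > 0 with M(r) ≤ t one has ‖T(t)∘R(0)‖ ≤ C/r. (Equivalently, ‖T(t)A^{−1}‖ ≤ C/M^{−1}(t) for all sufficiently large t, where M^{−1} is any right inverse of M; this is the main quantified decay theorem for uniformly bounded Hilbert-space semigroups with resolvent growth of positive increase.) -/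
open MeasureTheory
open scoped FourierTransform Topology ContDiff
open Filter Set

theorem fourier_toLp_two_ae_eq {E : Type*} [NormedAddCommGroup E] [InnerProductSpace ℂ E]
    [CompleteSpace E] {f : ℝ → E} (hf : Integrable f) (hf2 : MemLp f 2) :
    (𝓕 (hf2.toLp f) : Lp E 2 (volume : Measure ℝ)) =ᵐ[volume] 𝓕 f := by
  have hcont : Continuous (𝓕 f) :=
    VectorFourier.fourierIntegral_continuous Real.continuous_fourierChar
      (innerSL ℝ).continuous₂ hf
  refine ae_eq_of_integral_contDiff_smul_eq
    ((Lp.memLp _).locallyIntegrable one_le_two) hcont.locallyIntegrable fun g hg hgc => ?_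
  have hgc' : HasCompactSupport (Complex.ofRealCLM ∘ g) := hgc.comp_left rfl
  have hg' : ContDiff ℝ ∞ (Complex.ofRealCLM ∘ g) := by fun_prop
  set φ := hgc'.toSchwartzMap hg' with hφ
  have h1 := Lp.fourier_toTemperedDistribution_eq (hf2.toLp f)
  have h2 := congrArg (fun D => D φ) h1
  simp only [TemperedDistribution.fourier_apply, Lp.toTemperedDistribution_apply] at h2
  have h3 : ∫ x, (𝓕 φ) x • (hf2.toLp f) x = ∫ x, (𝓕 φ) x • f x := by
    apply integral_congr_ae
    filter_upwards [hf2.coeFn_toLp] with x hx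
    rw [hx]
  have h4 : ∫ x, (𝓕 φ) x • f x = ∫ x, φ x • (𝓕 f) x := by
    have := VectorFourier.integral_fourierIntegral_smul_eq_flip (μ := volume) (ν := volume)
      (L := innerₗ ℝ) Real.continuous_fourierChar continuous_inner φ.integrable hf
    rw [flip_innerₗ] at this
    exact this
  have hgφ : ∀ x (v : E), g x • v = φ x • v := fun x v => (Complex.coe_smul _ _).symm
  simp_rw [hgφ]
  rw [← h2, h3, h4]

theorem memLp_two_fourier {E : Type*} [NormedAddCommGroup E] [InnerProductSpace ℂ E]
    [CompleteSpace E] {f : ℝ → E} (hf : Integrable f) (hf2 : MemLp f 2) : MemLp (𝓕 f) 2 :=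
  (memLp_congr_ae (fourier_toLp_two_ae_eq hf hf2)).1 (Lp.memLp _)

theorem integral_norm_sq_fourier {E : Type*} [NormedAddCommGroup E] [InnerProductSpace ℂ E]
    [CompleteSpace E] {f : ℝ → E} (hf : Integrable f) (hf2 : MemLp f 2) :
    ∫ ξ, ‖𝓕 f ξ‖ ^ 2 = ∫ x, ‖f x‖ ^ 2 := by
  have key : ∀ g : Lp E 2 (volume : Measure ℝ), ∫ x, ‖g x‖ ^ 2 = ‖g‖ ^ 2 := fun g => by
    have := L2.inner_def (𝕜 := ℂ) g g
    simp only [inner_self_eq_norm_sq_to_K] at this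
    have hcast : ∫ a, ((‖g a‖ ^ 2 : ℝ) : ℂ) = ((∫ a, ‖g a‖ ^ 2 : ℝ) : ℂ) := integral_ofReal
    simp only [Complex.ofReal_pow] at hcast
    have h : (‖g‖ : ℂ) ^ 2 = ((∫ a, ‖g a‖ ^ 2 : ℝ) : ℂ) := this.trans hcast
    exact_mod_cast h.symm
  have h1 : ∫ ξ, ‖𝓕 f ξ‖ ^ 2 = ∫ ξ, ‖(𝓕 (hf2.toLp f) : Lp E 2 (volume : Measure ℝ)) ξ‖ ^ 2 := by
    apply integral_congr_ae
    filter_upwards [fourier_toLp_two_ae_eq hf hf2] with x hx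
    rw [hx]
  have h2 : ∫ x, ‖f x‖ ^ 2 = ∫ x, ‖(hf2.toLp f) x‖ ^ 2 := by
    apply integral_congr_ae
    filter_upwards [hf2.coeFn_toLp] with x hx
    rw [hx]
  rw [h1, h2, key, key, Lp.norm_fourier_eq]

theorem tendsto_resolvent_add_ofReal {X : Type*} [NormedAddCommGroup X] [NormedSpace ℂ X]
    {R : ℂ → (X →L[ℂ] X)}
    (hres : ∀ l μ : ℂ, 0 ≤ l.re → 0 ≤ μ.re →
      R l - R μ = (μ - l) • ((R l).comp (R μ))) {μ : ℂ} (hμ : 0 ≤ μ.re) :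
    Tendsto (fun ε : ℝ => R (μ + ε)) (𝓝[>] 0) (𝓝 (R μ)) := by
  set B := ‖R μ‖ with hB
  have hB0 : 0 ≤ B := norm_nonneg _
  have hle : ∀ ε : ℝ, 0 < ε → ε * B ≤ 1 / 2 → ‖R (μ + ε) - R μ‖ ≤ ε * (2 * B * B) := by
    intro ε hε hεB
    have hd : ‖R (μ + ε) - R μ‖ ≤ ε * (‖R (μ + ε)‖ * B) := by
      rw [hres (μ + ε) μ (by simp; linarith) hμ, norm_smul]
      simp only [sub_add_cancel_left, norm_neg, Complex.norm_real, Real.norm_eq_abs, abs_of_pos hε]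
      gcongr
      exact ContinuousLinearMap.opNorm_comp_le _ _
    have h2 : ‖R (μ + ε)‖ ≤ 2 * B := by
      have := norm_sub_norm_le (R (μ + ε)) (R μ)
      nlinarith [norm_nonneg (R (μ + ε))]
    calc _ ≤ _ := hd
      _ ≤ _ := by gcongr
  rw [tendsto_iff_norm_sub_tendsto_zero]
  have hlim : Tendsto (fun ε : ℝ => ε * (2 * B * B)) (𝓝[>] 0) (𝓝 0) := by
    have : Tendsto (fun ε : ℝ => ε * (2 * B * B)) (𝓝 0) (𝓝 (0 * (2 * B * B))) := by
      exact tendsto_id.mul_const _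
    rw [zero_mul] at this
    exact this.mono_left nhdsWithin_le_nhds
  refine squeeze_zero' (Eventually.of_forall fun _ => norm_nonneg _) ?_ hlim
  have h0 : Tendsto (fun ε : ℝ => ε * B) (𝓝[>] 0) (𝓝 0) := by
    have : Tendsto (fun ε : ℝ => ε * B) (𝓝 0) (𝓝 (0 * B)) := tendsto_id.mul_const _
    rw [zero_mul] at this
    exact this.mono_left nhdsWithin_le_nhds
  filter_upwards [self_mem_nhdsWithin, h0.eventually (ge_mem_nhds (by norm_num : (0:ℝ) < 1 / 2))]
    with ε h1 h2 using hle ε h1 h2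

theorem integrable_exp_smul_orbit {X : Type*} [NormedAddCommGroup X] [NormedSpace ℂ X]
    {T : ℝ → (X →L[ℂ] X)} {K : ℝ}
    (hTcont : ∀ x : X, Continuous fun t => T t x) (hTbdd : ∀ t, ‖T t‖ ≤ K)
    {l : ℂ} (hl : 0 < l.re) (x : X) :
    IntegrableOn (fun t : ℝ => Complex.exp (-(l * t)) • T t x) (Ioi 0) := by
  refine Integrable.mono' ((integrableOn_exp_mul_Ioi (neg_neg_iff_pos.2 hl) 0).mul_const (K * ‖x‖))
    ?_ (Eventually.of_forall fun t => ?_)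
  · have := hTcont x
    exact Continuous.aestronglyMeasurable (by fun_prop)
  · rw [norm_smul, Complex.norm_exp]
    simp only [Complex.neg_re, Complex.mul_re, Complex.ofReal_re, Complex.ofReal_im, mul_zero,
      sub_zero, neg_mul]
    gcongr
    exact (T t).le_of_opNorm_le (hTbdd t) x

theorem semigroup_comm_resolvent {X : Type*} [NormedAddCommGroup X] [NormedSpace ℂ X]
    [CompleteSpace X] {T : ℝ → (X →L[ℂ] X)} {K : ℝ}
    (hTsemi : ∀ s t : ℝ, 0 ≤ s → 0 ≤ t → T (s + t) = (T s).comp (T t))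
    (hTcont : ∀ x : X, Continuous fun t => T t x) (hTbdd : ∀ t, ‖T t‖ ≤ K)
    {R : ℂ → (X →L[ℂ] X)}
    (hres : ∀ l μ : ℂ, 0 ≤ l.re → 0 ≤ μ.re →
      R l - R μ = (μ - l) • ((R l).comp (R μ)))
    (hlap : ∀ l : ℂ, 0 < l.re → ∀ x : X,
      R l x = ∫ t in Ioi (0:ℝ), Complex.exp (-(l * t)) • T t x)
    {μ : ℂ} (hμ : 0 ≤ μ.re) {τ : ℝ} (hτ : 0 ≤ τ) (y : X) :
    T τ (R μ y) = R μ (T τ y) := by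
  have hpos : ∀ l : ℂ, 0 < l.re → T τ (R l y) = R l (T τ y) := by
    intro l hl
    rw [hlap l hl, hlap l hl, ← ContinuousLinearMap.integral_comp_comm _
      (integrable_exp_smul_orbit hTcont hTbdd hl y)]
    refine setIntegral_congr_fun measurableSet_Ioi fun t ht => ?_
    have h1 := hTsemi τ t hτ (le_of_lt ht)
    rw [add_comm, hTsemi t τ (le_of_lt ht) hτ] at h1
    have h2 := congrArg (fun A => A y) h1
    simp only [ContinuousLinearMap.comp_apply] at h2
    simp only [map_smul, h2]
  have ht : ∀ x, Tendsto (fun ε : ℝ => R (μ + ε) x) (𝓝[>] 0) (𝓝 (R μ x)) := fun x =>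
    ((ContinuousLinearMap.apply ℂ X x).continuous.tendsto _).comp
      (tendsto_resolvent_add_ofReal hres hμ)
  have h1 : Tendsto (fun ε : ℝ => T τ (R (μ + ε) y)) (𝓝[>] 0) (𝓝 (T τ (R μ y))) :=
    ((T τ).continuous.tendsto _).comp (ht y)
  have h2 : Tendsto (fun ε : ℝ => R (μ + ε) (T τ y)) (𝓝[>] 0) (𝓝 (R μ (T τ y))) :=
    ht _
  refine tendsto_nhds_unique (h1.congr' ?_) h2
  filter_upwards [self_mem_nhdsWithin] with ε hε
  exact hpos _ (by simp only [Complex.add_re, Complex.ofReal_re]; linarith [show 0 < ε from hε])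

theorem exp_smul_resolvent_orbit {X : Type*} [NormedAddCommGroup X] [NormedSpace ℂ X]
    [CompleteSpace X] {T : ℝ → (X →L[ℂ] X)} {K : ℝ}
    (hTsemi : ∀ s t : ℝ, 0 ≤ s → 0 ≤ t → T (s + t) = (T s).comp (T t))
    (hTcont : ∀ x : X, Continuous fun t => T t x) (hTbdd : ∀ t, ‖T t‖ ≤ K)
    {R : ℂ → (X →L[ℂ] X)}
    (hres : ∀ l μ : ℂ, 0 ≤ l.re → 0 ≤ μ.re →
      R l - R μ = (μ - l) • ((R l).comp (R μ)))
    (hlap : ∀ l : ℂ, 0 < l.re → ∀ x : X,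
      R l x = ∫ t in Ioi (0:ℝ), Complex.exp (-(l * t)) • T t x)
    {μ : ℂ} (hμ : 0 ≤ μ.re) {τ : ℝ} (hτ : 0 ≤ τ) (y : X) :
    Complex.exp (-(μ * τ)) • R μ (T τ y) =
      R μ y - ∫ s in (0:ℝ)..τ, Complex.exp (-(μ * s)) • T s y := by
  have hpos : ∀ l : ℂ, 0 < l.re → Complex.exp (-(l * τ)) • R l (T τ y) =
      R l y - ∫ s in (0:ℝ)..τ, Complex.exp (-(l * s)) • T s y := by
    intro l hl
    have hint := integrable_exp_smul_orbit hTcont hTbdd hl y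
    have hsplit := intervalIntegral.integral_interval_add_Ioi hint
      (hint.mono_set (Ioi_subset_Ioi hτ))
    have hshift := (measurePreserving_add_right (volume : Measure ℝ) τ).setIntegral_preimage_emb
      (measurableEmbedding_addRight τ) (fun s : ℝ => Complex.exp (-(l * s)) • T s y) (Ioi τ)
    rw [preimage_add_const_Ioi, sub_self] at hshift
    rw [hlap l hl y, hlap l hl (T τ y), ← hsplit, add_sub_cancel_left, ← hshift, ← integral_smul]
    refine setIntegral_congr_fun measurableSet_Ioi fun t ht => ?_
    simp only [hTsemi t τ (le_of_lt ht) hτ, ContinuousLinearMap.comp_apply, smul_smul,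
      ← Complex.exp_add]
    congr 2
    push_cast
    ring
  have hpar : Continuous fun ε : ℝ =>
      ∫ s in (0:ℝ)..τ, Complex.exp (-((μ + ε) * s)) • T s y := by
    refine intervalIntegral.continuous_parametric_intervalIntegral_of_continuous' ?_ _ _
    have : Continuous fun p : ℝ × ℝ => T p.2 y := (hTcont y).comp continuous_snd
    simp only [Function.uncurry_def]
    fun_prop
  have ht : ∀ x, Tendsto (fun ε : ℝ => R (μ + ε) x) (𝓝[>] 0) (𝓝 (R μ x)) := fun x =>
    ((ContinuousLinearMap.apply ℂ X x).continuous.tendsto _).comp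
      (tendsto_resolvent_add_ofReal hres hμ)
  have h0 : Tendsto (fun ε : ℝ => Complex.exp (-((μ + ε) * τ))) (𝓝[>] 0)
      (𝓝 (Complex.exp (-(μ * τ)))) := by
    have : Continuous fun ε : ℝ => Complex.exp (-((μ + ε) * τ)) := by fun_prop
    have := this.tendsto 0
    simp only [Complex.ofReal_zero, add_zero] at this
    exact this.mono_left nhdsWithin_le_nhds
  have h1 := h0.smul (ht (T τ y))
  have h3 := hpar.tendsto 0
  simp only [Complex.ofReal_zero, add_zero] at h3
  have h2 := (ht y).sub (h3.mono_left nhdsWithin_le_nhds)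
  refine tendsto_nhds_unique (h1.congr' ?_) h2
  filter_upwards [self_mem_nhdsWithin] with ε hε
  exact hpos _ (by simp only [Complex.add_re, Complex.ofReal_re]; linarith [show 0 < ε from hε])

theorem integral_smul_orbit_eq_resolvent {X : Type*} [NormedAddCommGroup X] [NormedSpace ℂ X]
    [CompleteSpace X] {T : ℝ → (X →L[ℂ] X)} {K : ℝ}
    (hTsemi : ∀ s t : ℝ, 0 ≤ s → 0 ≤ t → T (s + t) = (T s).comp (T t))
    (hTcont : ∀ x : X, Continuous fun t => T t x) (hTbdd : ∀ t, ‖T t‖ ≤ K)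
    {R : ℂ → (X →L[ℂ] X)}
    (hres : ∀ l μ : ℂ, 0 ≤ l.re → 0 ≤ μ.re →
      R l - R μ = (μ - l) • ((R l).comp (R μ)))
    (hlap : ∀ l : ℂ, 0 < l.re → ∀ x : X,
      R l x = ∫ t in Ioi (0:ℝ), Complex.exp (-(l * t)) • T t x)
    {μ : ℂ} (hμ : 0 ≤ μ.re) (y : X) {φ φ' : ℝ → ℝ} (hφ : ∀ x, HasDerivAt φ (φ' x) x)
    (hφ' : Continuous φ') (hsupp : HasCompactSupport φ) (hsupp' : HasCompactSupport φ')
    (hneg : ∀ x < 0, φ' x = 0) :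
    ∫ τ : ℝ, φ τ • Complex.exp (-(μ * τ)) • T τ y =
      R μ (∫ τ : ℝ, φ' τ • Complex.exp (-(μ * τ)) • T τ y) := by
  have hφc : Continuous φ := continuous_iff_continuousAt.2 fun x => (hφ x).continuousAt
  have hw : Continuous fun τ : ℝ => Complex.exp (-(μ * τ)) • T τ y := by
    have := hTcont y
    fun_prop
  set W : ℝ → X := fun τ => R μ y - ∫ s in (0:ℝ)..τ, Complex.exp (-(μ * s)) • T s y with hW
  have hWd : ∀ τ : ℝ, HasDerivAt W (-(Complex.exp (-(μ * τ)) • T τ y)) τ := fun τ =>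
    (intervalIntegral.integral_hasDerivAt_right (hw.intervalIntegrable _ _)
      (hw.stronglyMeasurableAtFilter _ _) hw.continuousAt).const_sub _
  have hWc : Continuous W := continuous_iff_continuousAt.2 fun x => (hWd x).continuousAt
  have hparts := integral_bilinear_hasDerivAt_right_eq_neg_left_of_integrable
    (L := ContinuousLinearMap.lsmul ℝ ℝ) (u := φ) (v := W) (u' := φ')
    (v' := fun τ : ℝ => -(Complex.exp (-(μ * τ)) • T τ y)) (fun x _ => hφ x) (fun x _ => hWd x)
    ((hφc.smul hw.neg).integrable_of_hasCompactSupport hsupp.smul_right)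
    ((hφ'.smul hWc).integrable_of_hasCompactSupport hsupp'.smul_right)
    ((hφc.smul hWc).integrable_of_hasCompactSupport hsupp.smul_right)
  simp only [ContinuousLinearMap.lsmul_apply, smul_neg, integral_neg, neg_inj] at hparts
  have hint : Integrable fun τ : ℝ => φ' τ • Complex.exp (-(μ * τ)) • T τ y :=
    (hφ'.smul hw).integrable_of_hasCompactSupport hsupp'.smul_right
  rw [hparts, ← ContinuousLinearMap.integral_comp_comm _ hint]
  refine integral_congr_ae (Eventually.of_forall fun τ => ?_)
  rcases lt_or_ge τ 0 with h | h
  · simp [hneg τ h]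
  · have := exp_smul_resolvent_orbit hTsemi hTcont hTbdd hres hlap hμ h y
    simp only [hW, ← this]
    rw [← Complex.coe_smul, ← Complex.coe_smul, map_smul, map_smul]

theorem iteratedDeriv_regularity {η : ℝ → ℝ} (hη : ContDiff ℝ ∞ η) (hc : HasCompactSupport η)
    (hneg : tsupport η ⊆ Ioi 0) (k : ℕ) :
    Continuous (iteratedDeriv k η) ∧ HasCompactSupport (iteratedDeriv k η) ∧
      (∀ x < 0, iteratedDeriv k η x = 0) ∧
      ∀ x, HasDerivAt (iteratedDeriv k η) (iteratedDeriv (k + 1) η x) x := by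
  have hsupp : tsupport (iteratedDeriv k η) ⊆ tsupport η := by
    induction k with
    | zero => simp
    | succ k ih =>
      rw [iteratedDeriv_succ]
      exact (closure_minimal support_deriv_subset (isClosed_tsupport _)).trans ih
  refine ⟨hη.continuous_iteratedDeriv k (by exact_mod_cast le_top),
    hc.mono' ((subset_tsupport _).trans hsupp), fun x hx => ?_, fun x => ?_⟩
  · by_contra h
    exact absurd (hneg (hsupp (subset_tsupport _ h))) (not_lt.2 hx.le)
  · rw [iteratedDeriv_succ]
    exact ((hη.differentiable_iteratedDeriv k (by exact_mod_cast WithTop.coe_lt_top k)) x).hasDerivAt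

theorem fourier_eq_integral_exp_smul {E : Type*} [NormedAddCommGroup E] [NormedSpace ℂ E]
    (f : ℝ → E) (ξ : ℝ) :
    𝓕 f ξ = ∫ τ : ℝ, Complex.exp (-(((2 * Real.pi * ξ : ℝ) * Complex.I) * τ)) • f τ := by
  rw [Real.fourier_real_eq_integral_exp_smul]
  congr 1
  ext τ
  congr 2
  push_cast
  ring

theorem norm_resolvent_zero_comp_pow_le {X : Type*} [NormedAddCommGroup X] [NormedSpace ℂ X]
    {R : ℂ → (X →L[ℂ] X)}
    (hres : ∀ l μ : ℂ, 0 ≤ l.re → 0 ≤ μ.re →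
      R l - R μ = (μ - l) • ((R l).comp (R μ)))
    {M : ℝ → ℝ} (hMpos : ∀ s : ℝ, 0 ≤ s → 0 < M s)
    (hMmono : ∀ s t : ℝ, 0 ≤ s → s ≤ t → M s ≤ M t)
    (hMR : ∀ ξ : ℝ, ‖R (ξ * Complex.I)‖ ≤ M |ξ|)
    {α c s₀ : ℝ} (hc0 : 0 < c) (hs₀ : 0 < s₀)
    (hPI : ∀ l s : ℝ, 1 ≤ l → s₀ ≤ s → c * l ^ α * M s ≤ M (l * s))
    {n : ℕ} (hn : 1 ≤ n * α) {r : ℝ} (hr : s₀ ≤ r) {ξ : ℝ} (hξ : |ξ| ≤ r) :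
    ‖R 0 * R (ξ * Complex.I) ^ n‖ ≤ (2 + M 0 * s₀) / c ^ n * M r ^ n / r := by
  have hrpos : 0 < r := hs₀.trans_le hr
  have hR0 : ‖R 0‖ ≤ M 0 := by simpa using hMR 0
  have hM0 := hMpos 0 le_rfl
  have hgrow : ∀ s, s₀ ≤ s → s ≤ r → M s ^ n / s ≤ M r ^ n / c ^ n / r := by
    intro s hs hsr
    have hspos : 0 < s := hs₀.trans_le hs
    have hl : 1 ≤ r / s := (one_le_div hspos).2 hsr
    have h1 := hPI (r / s) s hl hs
    rw [div_mul_cancel₀ _ hspos.ne'] at h1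
    have h2 : (c * (r / s) ^ α * M s) ^ n ≤ M r ^ n := by
      have := hMpos s hspos.le
      gcongr
    have h3 : r / s ≤ ((r / s) ^ α) ^ n := by
      rw [← Real.rpow_natCast, ← Real.rpow_mul (by positivity)]
      calc r / s = (r / s) ^ (1 : ℝ) := (Real.rpow_one _).symm
        _ ≤ _ := Real.rpow_le_rpow_of_exponent_le hl (by linarith [mul_comm (n : ℝ) α])
    have h4 : c ^ n * (r / s) * M s ^ n ≤ M r ^ n := by
      refine le_trans ?_ h2
      rw [mul_pow, mul_pow]
      have := hMpos s hspos.le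
      gcongr
    rw [le_div_iff₀ hrpos, le_div_iff₀ (by positivity)]
    calc M s ^ n / s * r * c ^ n = c ^ n * (r / s) * M s ^ n := by ring
      _ ≤ _ := h4
  have hMr := hMpos r hrpos.le
  have hscale : (2 + M 0 * s₀) / c ^ n * M r ^ n / r =
      (2 + M 0 * s₀) * (M r ^ n / c ^ n / r) := by ring
  rw [hscale]
  set Q := M r ^ n / c ^ n / r with hQ
  have hQ0 : 0 ≤ Q := by positivity
  rcases le_total s₀ |ξ| with h | h
  · have hξpos : 0 < |ξ| := hs₀.trans_le h
    obtain ⟨m, rfl⟩ : ∃ m, n = m + 1 := by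
      refine Nat.exists_eq_succ_of_ne_zero fun h0 => ?_
      rw [h0] at hn
      norm_num at hn
    have hMξ := hMpos |ξ| hξpos.le
    have h0ξ : M 0 ≤ M |ξ| := hMmono 0 _ le_rfl hξpos.le
    have hid := hres 0 (ξ * Complex.I) le_rfl (by simp)
    rw [sub_zero] at hid
    have hnorm : |ξ| * ‖R 0 * R (ξ * Complex.I)‖ ≤ 2 * M |ξ| := by
      calc |ξ| * ‖R 0 * R (ξ * Complex.I)‖ = ‖R 0 - R (ξ * Complex.I)‖ := by
            rw [hid, norm_smul]
            simp [ContinuousLinearMap.mul_def]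
        _ ≤ ‖R 0‖ + ‖R (ξ * Complex.I)‖ := norm_sub_le _ _
        _ ≤ 2 * M |ξ| := by linarith [hMR ξ]
    have hpow : ‖R (ξ * Complex.I) ^ m‖ ≤ M |ξ| ^ m := by
      rcases Nat.eq_zero_or_pos m with rfl | hm
      · rw [pow_zero, pow_zero]
        exact ContinuousLinearMap.norm_id_le
      · exact (norm_pow_le' _ hm).trans (by gcongr; exact hMR ξ)
    have h5 : ‖R 0 * R (ξ * Complex.I) ^ (m + 1)‖ ≤ 2 * (M |ξ| ^ (m + 1) / |ξ|) := by
      rw [pow_succ', ← mul_assoc]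
      calc _ ≤ ‖R 0 * R (ξ * Complex.I)‖ * ‖R (ξ * Complex.I) ^ m‖ := norm_mul_le _ _
        _ ≤ (2 * M |ξ| / |ξ|) * M |ξ| ^ m := by
            gcongr
            rw [le_div_iff₀ hξpos]
            linarith
        _ = _ := by ring
    calc _ ≤ _ := h5
      _ ≤ 2 * Q := by gcongr; exact hgrow _ h hξ
      _ ≤ _ := by
        gcongr
        have : 0 ≤ M 0 * s₀ := by positivity
        linarith
  · have hpow : ‖R (ξ * Complex.I) ^ n‖ ≤ M s₀ ^ n := by
      have hb : ‖R (ξ * Complex.I)‖ ≤ M s₀ := (hMR ξ).trans (hMmono _ _ (abs_nonneg _) h)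
      rcases Nat.eq_zero_or_pos n with rfl | hm
      · rw [pow_zero, pow_zero]
        exact ContinuousLinearMap.norm_id_le
      · exact (norm_pow_le' _ hm).trans (by gcongr)
    have h6 := hgrow s₀ le_rfl hr
    rw [div_le_iff₀ hs₀] at h6
    calc _ ≤ ‖R 0‖ * ‖R (ξ * Complex.I) ^ n‖ := norm_mul_le _ _
      _ ≤ M 0 * (Q * s₀) := by gcongr; exact hpow.trans h6
      _ ≤ (2 + M 0 * s₀) * Q := by nlinarith

/-- The smoothly truncated orbit `τ ↦ η⁽ᵏ⁾(τ / t) T(τ) y`. -/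
noncomputable def truncatedOrbit {X : Type*} [NormedAddCommGroup X] [NormedSpace ℂ X]
    (T : ℝ → (X →L[ℂ] X)) (η : ℝ → ℝ) (t : ℝ) (y : X) (k : ℕ) (τ : ℝ) : X :=
  iteratedDeriv k η (τ / t) • T τ y

section truncatedOrbit

variable {X : Type*} [NormedAddCommGroup X] [NormedSpace ℂ X]
  {T : ℝ → (X →L[ℂ] X)} {K : ℝ} {η : ℝ → ℝ} {t : ℝ}

theorem hasCompactSupport_comp_div {f : ℝ → ℝ} (hf : HasCompactSupport f) (ht : 0 < t) :
    HasCompactSupport fun τ => f (τ / t) := by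
  have := hf.comp_homeomorph (Homeomorph.mulRight₀ t⁻¹ (inv_pos.2 ht).ne')
  simpa [Function.comp_def, div_eq_mul_inv] using this

theorem continuous_truncatedOrbit (hη : ContDiff ℝ ∞ η) (hc : HasCompactSupport η)
    (hpos : tsupport η ⊆ Ioi 0) (hTcont : ∀ x : X, Continuous fun t => T t x) (y : X) (k : ℕ) :
    Continuous (truncatedOrbit T η t y k) := by
  have h1 := (iteratedDeriv_regularity hη hc hpos k).1
  have h2 := hTcont y
  unfold truncatedOrbit
  fun_prop

theorem hasCompactSupport_truncatedOrbit (hη : ContDiff ℝ ∞ η) (hc : HasCompactSupport η)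
    (hpos : tsupport η ⊆ Ioi 0) (ht : 0 < t) (y : X) (k : ℕ) :
    HasCompactSupport (truncatedOrbit T η t y k) :=
  (hasCompactSupport_comp_div (iteratedDeriv_regularity hη hc hpos k).2.1 ht).smul_right

theorem integral_norm_sq_truncatedOrbit_le (hη : ContDiff ℝ ∞ η) (hc : HasCompactSupport η)
    (hpos : tsupport η ⊆ Ioi 0) (hTbdd : ∀ t, ‖T t‖ ≤ K) (ht : 0 < t) (y : X) (k : ℕ) :
    ∫ τ, ‖truncatedOrbit T η t y k τ‖ ^ 2 ≤
      t * (K * ‖y‖) ^ 2 * ∫ x, iteratedDeriv k η x ^ 2 := by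
  obtain ⟨h1, h2, -, -⟩ := iteratedDeriv_regularity hη hc hpos k
  have hint : Integrable fun τ : ℝ => iteratedDeriv k η (τ / t) ^ 2 * (K * ‖y‖) ^ 2 := by
    refine Integrable.mul_const ?_ _
    refine Continuous.integrable_of_hasCompactSupport (by fun_prop) ?_
    exact hasCompactSupport_comp_div (f := fun x => iteratedDeriv k η x ^ 2)
      (h2.comp_left (g := fun x => x ^ 2) (by simp)) ht
  calc _ ≤ ∫ τ, iteratedDeriv k η (τ / t) ^ 2 * (K * ‖y‖) ^ 2 := by
        refine integral_mono_of_nonneg (Eventually.of_forall fun τ => by positivity) hint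
          (Eventually.of_forall fun τ => ?_)
        simp only [truncatedOrbit, norm_smul]
        rw [mul_pow, Real.norm_eq_abs, sq_abs]
        gcongr
        exact (T τ).le_of_opNorm_le (hTbdd τ) y
    _ = _ := by
        rw [integral_mul_const,
          Measure.integral_comp_div (fun x => iteratedDeriv k η x ^ 2) t, abs_of_pos ht, smul_eq_mul]
        ring

theorem fourier_truncatedOrbit_succ [CompleteSpace X]
    (hTsemi : ∀ s t : ℝ, 0 ≤ s → 0 ≤ t → T (s + t) = (T s).comp (T t))
    (hTcont : ∀ x : X, Continuous fun t => T t x) (hTbdd : ∀ t, ‖T t‖ ≤ K)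
    {R : ℂ → (X →L[ℂ] X)}
    (hres : ∀ l μ : ℂ, 0 ≤ l.re → 0 ≤ μ.re →
      R l - R μ = (μ - l) • ((R l).comp (R μ)))
    (hlap : ∀ l : ℂ, 0 < l.re → ∀ x : X,
      R l x = ∫ t in Ioi (0:ℝ), Complex.exp (-(l * t)) • T t x)
    (hη : ContDiff ℝ ∞ η) (hc : HasCompactSupport η) (hpos : tsupport η ⊆ Ioi 0)
    (ht : 0 < t) (y : X) (k : ℕ) (ξ : ℝ) :
    𝓕 (truncatedOrbit T η t y k) ξ =
      (t : ℂ)⁻¹ • R ((2 * Real.pi * ξ : ℝ) * Complex.I)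
        (𝓕 (truncatedOrbit T η t y (k + 1)) ξ) := by
  obtain ⟨h1, h2, -, h4⟩ := iteratedDeriv_regularity hη hc hpos k
  obtain ⟨g1, g2, g3, -⟩ := iteratedDeriv_regularity hη hc hpos (k + 1)
  have key := integral_smul_orbit_eq_resolvent hTsemi hTcont hTbdd hres hlap
    (μ := (2 * Real.pi * ξ : ℝ) * Complex.I) (by simp) y
    (φ := fun τ => iteratedDeriv k η (τ / t)) (φ' := fun τ => iteratedDeriv (k + 1) η (τ / t) * t⁻¹)
    (fun x => by
      have := (h4 (x / t)).comp x ((hasDerivAt_id x).div_const t)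
      simpa [Function.comp_def] using this)
    (by fun_prop) (hasCompactSupport_comp_div h2 ht) (hasCompactSupport_comp_div g2 ht).mul_right
    (fun x hx => by rw [g3 _ (div_neg_of_neg_of_pos hx ht), zero_mul])
  rw [fourier_eq_integral_exp_smul, fourier_eq_integral_exp_smul, ← map_smul, ← integral_smul]
  have e1 : ∀ (a : ℝ) (z : ℂ) (x : X), z • a • x = a • z • x := fun a z x => smul_comm _ _ _
  have e2 : ∀ (a : ℝ) (x : X), (a * t⁻¹) • x = (t : ℂ)⁻¹ • a • x := fun a x => by
    rw [mul_comm, mul_smul, ← Complex.ofReal_inv, Complex.coe_smul]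
  simp only [e2] at key
  simp only [truncatedOrbit, e1]
  simpa only [e1] using key

theorem fourier_truncatedOrbit_zero_eq_pow [CompleteSpace X]
    (hTsemi : ∀ s t : ℝ, 0 ≤ s → 0 ≤ t → T (s + t) = (T s).comp (T t))
    (hTcont : ∀ x : X, Continuous fun t => T t x) (hTbdd : ∀ t, ‖T t‖ ≤ K)
    {R : ℂ → (X →L[ℂ] X)}
    (hres : ∀ l μ : ℂ, 0 ≤ l.re → 0 ≤ μ.re →
      R l - R μ = (μ - l) • ((R l).comp (R μ)))
    (hlap : ∀ l : ℂ, 0 < l.re → ∀ x : X,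
      R l x = ∫ t in Ioi (0:ℝ), Complex.exp (-(l * t)) • T t x)
    (hη : ContDiff ℝ ∞ η) (hc : HasCompactSupport η) (hpos : tsupport η ⊆ Ioi 0)
    (ht : 0 < t) (y : X) (k : ℕ) (ξ : ℝ) :
    𝓕 (truncatedOrbit T η t y 0) ξ =
      ((t : ℂ) ^ k)⁻¹ • (R ((2 * Real.pi * ξ : ℝ) * Complex.I) ^ k)
        (𝓕 (truncatedOrbit T η t y k) ξ) := by
  induction k with
  | zero => simp
  | succ k ih =>
    rw [ih, fourier_truncatedOrbit_succ hTsemi hTcont hTbdd hres hlap hη hc hpos ht y k ξ,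
      map_smul, smul_smul, pow_succ, pow_succ, mul_inv, mul_apply_eq_comp]

end truncatedOrbit

theorem exists_smooth_plateau : ∃ η : ℝ → ℝ, ContDiff ℝ ∞ η ∧ HasCompactSupport η ∧
    tsupport η ⊆ Ioi 0 ∧ ∀ x ∈ Icc (1 / 2 : ℝ) 1, η x = 1 := by
  let b : ContDiffBump (1 : ℝ) := ⟨1 / 2, 3 / 4, by norm_num, by norm_num⟩
  refine ⟨b, b.contDiff, b.hasCompactSupport, ?_, fun x hx => b.one_of_mem_closedBall ?_⟩
  · rw [b.tsupport_eq, Real.closedBall_eq_Icc]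
    intro x hx
    have : 1 - 3 / 4 ≤ x := hx.1
    exact lt_of_lt_of_le (by norm_num) this
  · rw [Real.closedBall_eq_Icc]
    exact ⟨by show (1 - 1 / 2 : ℝ) ≤ x; linarith [hx.1],
      by show x ≤ (1 + 1 / 2 : ℝ); linarith [hx.2]⟩

theorem norm_resolvent_zero_fourier_sq_le {X : Type*} [NormedAddCommGroup X] [NormedSpace ℂ X]
    [CompleteSpace X] {T : ℝ → (X →L[ℂ] X)} {K : ℝ}
    (hTsemi : ∀ s t : ℝ, 0 ≤ s → 0 ≤ t → T (s + t) = (T s).comp (T t))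
    (hTcont : ∀ x : X, Continuous fun t => T t x) (hTbdd : ∀ t, ‖T t‖ ≤ K)
    {R : ℂ → (X →L[ℂ] X)}
    (hres : ∀ l μ : ℂ, 0 ≤ l.re → 0 ≤ μ.re →
      R l - R μ = (μ - l) • ((R l).comp (R μ)))
    (hlap : ∀ l : ℂ, 0 < l.re → ∀ x : X,
      R l x = ∫ t in Ioi (0:ℝ), Complex.exp (-(l * t)) • T t x)
    {M : ℝ → ℝ} (hMpos : ∀ s : ℝ, 0 ≤ s → 0 < M s)
    (hMmono : ∀ s t : ℝ, 0 ≤ s → s ≤ t → M s ≤ M t)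
    (hMR : ∀ ξ : ℝ, ‖R (ξ * Complex.I)‖ ≤ M |ξ|)
    {α c s₀ : ℝ} (hc0 : 0 < c) (hs₀ : 0 < s₀)
    (hPI : ∀ l s : ℝ, 1 ≤ l → s₀ ≤ s → c * l ^ α * M s ≤ M (l * s))
    {n : ℕ} (hn : 1 ≤ n * α) {η : ℝ → ℝ}
    (hη : ContDiff ℝ ∞ η) (hc : HasCompactSupport η) (hpos : tsupport η ⊆ Ioi 0)
    {t : ℝ} (ht : 1 ≤ t) {r : ℝ} (hr : s₀ ≤ r) (hMr : M r ≤ t) (y : X) (ξ : ℝ) :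
    ‖R 0 (𝓕 (truncatedOrbit T η t y 0) ξ)‖ ^ 2 ≤
      (r ^ 2)⁻¹ * (((2 + M 0 * s₀) / c ^ n) ^ 2 * ‖𝓕 (truncatedOrbit T η t y n) ξ‖ ^ 2 +
        2 * (M 0 ^ 2 * ‖𝓕 (truncatedOrbit T η t y 1) ξ‖ ^ 2 +
          ‖𝓕 (truncatedOrbit T η t y 0) ξ‖ ^ 2)) := by
  have ht0 : 0 < t := by linarith
  have hrpos : 0 < r := hs₀.trans_le hr
  have hM0 := hMpos 0 le_rfl
  have hR0 : ‖R 0‖ ≤ M 0 := by simpa using hMR 0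
  set H : ℕ → X := fun k => 𝓕 (truncatedOrbit T η t y k) ξ with hH
  set s : ℝ := 2 * Real.pi * ξ with hs
  change ‖R 0 (H 0)‖ ^ 2 ≤ (r ^ 2)⁻¹ * (((2 + M 0 * s₀) / c ^ n) ^ 2 * ‖H n‖ ^ 2 +
        2 * (M 0 ^ 2 * ‖H 1‖ ^ 2 + ‖H 0‖ ^ 2))
  rcases le_or_gt |s| r with h | h
  · have e : H 0 = ((t : ℂ) ^ n)⁻¹ • (R (s * Complex.I) ^ n) (H n) :=
      fourier_truncatedOrbit_zero_eq_pow hTsemi hTcont hTbdd hres hlap hη hc hpos ht0 y n ξ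
    have hb := norm_resolvent_zero_comp_pow_le hres hMpos hMmono hMR hc0 hs₀ hPI hn hr h
    have hMrpos := hMpos r hrpos.le
    have h1 : ‖R 0 (H 0)‖ ≤ (2 + M 0 * s₀) / c ^ n / r * ‖H n‖ := by
      rw [e, map_smul, norm_smul, ← mul_apply_eq_comp]
      have h2 : ‖((t : ℂ) ^ n)⁻¹‖ = (t ^ n)⁻¹ := by
        rw [norm_inv, norm_pow, Complex.norm_real, Real.norm_eq_abs, abs_of_pos ht0]
      have h3 : ‖(R 0 * R (s * Complex.I) ^ n) (H n)‖ ≤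
          (2 + M 0 * s₀) / c ^ n * t ^ n / r * ‖H n‖ :=
        ContinuousLinearMap.le_of_opNorm_le _ (hb.trans (by gcongr)) _
      rw [h2]
      calc _ ≤ (t ^ n)⁻¹ * ((2 + M 0 * s₀) / c ^ n * t ^ n / r * ‖H n‖) := by gcongr
        _ = _ := by field_simp
    calc ‖R 0 (H 0)‖ ^ 2 ≤ ((2 + M 0 * s₀) / c ^ n / r * ‖H n‖) ^ 2 := by gcongr
      _ = (r ^ 2)⁻¹ * (((2 + M 0 * s₀) / c ^ n) ^ 2 * ‖H n‖ ^ 2) := by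
          field_simp
      _ ≤ _ := by gcongr; exact le_add_of_nonneg_right (by positivity)
  · have e : H 0 = (t : ℂ)⁻¹ • R (s * Complex.I) (H 1) :=
      fourier_truncatedOrbit_succ hTsemi hTcont hTbdd hres hlap hη hc hpos ht0 y 0 ξ
    have hid := hres 0 (s * Complex.I) le_rfl (by simp)
    rw [sub_zero] at hid
    have hid' := congrArg (fun A => (t : ℂ)⁻¹ • A (H 1)) hid
    simp only [sub_apply, smul_apply,
      ContinuousLinearMap.comp_apply, smul_sub] at hid'
    rw [← e, smul_comm ((t : ℂ)⁻¹) ((s : ℂ) * Complex.I),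
      ← map_smul (R 0) ((t : ℂ)⁻¹) (R (s * Complex.I) (H 1)), ← e] at hid'
    have h1 : |s| * ‖R 0 (H 0)‖ ≤ M 0 * ‖H 1‖ + ‖H 0‖ := by
      calc |s| * ‖R 0 (H 0)‖ = ‖(s * Complex.I) • R 0 (H 0)‖ := by
            rw [norm_smul]
            simp
        _ ≤ ‖(t : ℂ)⁻¹ • R 0 (H 1)‖ + ‖H 0‖ := by rw [← hid']; exact norm_sub_le _ _
        _ ≤ _ := by
            gcongr
            rw [norm_smul, norm_inv, Complex.norm_real, Real.norm_eq_abs, abs_of_pos ht0]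
            calc t⁻¹ * ‖R 0 (H 1)‖ ≤ 1 * ‖R 0 (H 1)‖ := by
                  gcongr
                  exact inv_le_one_of_one_le₀ ht
              _ ≤ _ := by rw [one_mul]; exact (R 0).le_of_opNorm_le hR0 _
    have h2 : r * ‖R 0 (H 0)‖ ≤ M 0 * ‖H 1‖ + ‖H 0‖ := le_trans (by gcongr) h1
    have h3 : (r * ‖R 0 (H 0)‖) ^ 2 ≤ (M 0 * ‖H 1‖ + ‖H 0‖) ^ 2 := by gcongr
    have h4 : (M 0 * ‖H 1‖ + ‖H 0‖) ^ 2 ≤ 2 * (M 0 ^ 2 * ‖H 1‖ ^ 2 + ‖H 0‖ ^ 2) := by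
      nlinarith [sq_nonneg (M 0 * ‖H 1‖ - ‖H 0‖)]
    rw [← div_eq_inv_mul, le_div_iff₀ (by positivity)]
    have h5 : 0 ≤ ((2 + M 0 * s₀) / c ^ n) ^ 2 * ‖H n‖ ^ 2 := by positivity
    nlinarith

theorem norm_comp_resolvent_zero_le_div {X : Type*} [NormedAddCommGroup X] [InnerProductSpace ℂ X]
    [CompleteSpace X] {T : ℝ → (X →L[ℂ] X)} {K : ℝ}
    (hTsemi : ∀ s t : ℝ, 0 ≤ s → 0 ≤ t → T (s + t) = (T s).comp (T t))
    (hTcont : ∀ x : X, Continuous fun t => T t x) (hTbdd : ∀ t, ‖T t‖ ≤ K)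
    {R : ℂ → (X →L[ℂ] X)}
    (hres : ∀ l μ : ℂ, 0 ≤ l.re → 0 ≤ μ.re →
      R l - R μ = (μ - l) • ((R l).comp (R μ)))
    (hlap : ∀ l : ℂ, 0 < l.re → ∀ x : X,
      R l x = ∫ t in Ioi (0:ℝ), Complex.exp (-(l * t)) • T t x)
    {M : ℝ → ℝ} (hMpos : ∀ s : ℝ, 0 ≤ s → 0 < M s)
    (hMmono : ∀ s t : ℝ, 0 ≤ s → s ≤ t → M s ≤ M t)
    (hMR : ∀ ξ : ℝ, ‖R (ξ * Complex.I)‖ ≤ M |ξ|)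
    {α c s₀ : ℝ} (hα : 0 < α) (hc0 : 0 < c) (hs₀ : 0 < s₀)
    (hPI : ∀ l s : ℝ, 1 ≤ l → s₀ ≤ s → c * l ^ α * M s ≤ M (l * s)) :
    ∃ C : ℝ, 0 ≤ C ∧ ∀ t : ℝ, 1 ≤ t → ∀ r : ℝ, s₀ ≤ r → M r ≤ t →
      ‖(T t).comp (R 0)‖ ≤ C / r := by
  have hK : 0 ≤ K := (norm_nonneg _).trans (hTbdd 0)
  have hM0 := hMpos 0 le_rfl
  obtain ⟨n, hn⟩ := exists_nat_ge (1 / α)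
  rw [div_le_iff₀ hα] at hn
  obtain ⟨η, hη, hc, hpos, hone⟩ := exists_smooth_plateau
  set I : ℕ → ℝ := fun k => ∫ x, iteratedDeriv k η x ^ 2 with hI
  have hI0 : ∀ k, 0 ≤ I k := fun k => integral_nonneg fun x => sq_nonneg _
  set C₁ := (2 + M 0 * s₀) / c ^ n with hC₁
  set D := C₁ ^ 2 * I n + 2 * (M 0 ^ 2 * I 1 + I 0) with hD
  have hD0 : 0 ≤ D := by have := hI0; positivity
  refine ⟨K ^ 2 * √(2 * D), by positivity, fun t ht r hr hMr => ?_⟩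
  have ht0 : 0 < t := by linarith
  have hrpos : 0 < r := hs₀.trans_le hr
  refine ContinuousLinearMap.opNorm_le_bound _ (by positivity) fun y => ?_
  set u := truncatedOrbit T η t y with hu
  have hcont : ∀ k, Continuous (u k) := continuous_truncatedOrbit hη hc hpos hTcont y
  have hcs : ∀ k, HasCompactSupport (u k) := hasCompactSupport_truncatedOrbit hη hc hpos ht0 y
  have hint : ∀ k, Integrable (u k) := fun k =>
    (hcont k).integrable_of_hasCompactSupport (hcs k)
  have hL2 : ∀ k, MemLp (u k) 2 := fun k => (hcont k).memLp_of_hasCompactSupport (hcs k)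
  have hF : ∀ k, Integrable fun ξ => ‖𝓕 (u k) ξ‖ ^ 2 := fun k =>
    (memLp_two_iff_integrable_sq_norm (memLp_two_fourier (hint k) (hL2 k)).1).1
      (memLp_two_fourier (hint k) (hL2 k))
  have hFle : ∀ k, ∫ ξ, ‖𝓕 (u k) ξ‖ ^ 2 ≤ t * (K * ‖y‖) ^ 2 * I k := fun k => by
    rw [integral_norm_sq_fourier (hint k) (hL2 k)]
    exact integral_norm_sq_truncatedOrbit_le hη hc hpos hTbdd ht0 y k
  have hvcont : Continuous fun τ => R 0 (u 0 τ) := (R 0).continuous.comp (hcont 0)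
  have hvcs : HasCompactSupport fun τ => R 0 (u 0 τ) := (hcs 0).comp_left (map_zero (R 0))
  have hvF : ∀ ξ, 𝓕 (fun τ => R 0 (u 0 τ)) ξ = R 0 (𝓕 (u 0) ξ) := fun ξ => by
    have hi : Integrable fun τ : ℝ =>
        Complex.exp (-(((2 * Real.pi * ξ : ℝ) * Complex.I) * τ)) • u 0 τ :=
      Continuous.integrable_of_hasCompactSupport (by have := hcont 0; fun_prop) (hcs 0).smul_left
    rw [fourier_eq_integral_exp_smul, fourier_eq_integral_exp_smul,
      ← ContinuousLinearMap.integral_comp_comm _ hi]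
    simp only [map_smul]
  have hupper : ∫ τ, ‖R 0 (u 0 τ)‖ ^ 2 ≤ (r ^ 2)⁻¹ * (t * (K * ‖y‖) ^ 2 * D) := by
    rw [← integral_norm_sq_fourier (hvcont.integrable_of_hasCompactSupport hvcs)
      (hvcont.memLp_of_hasCompactSupport hvcs)]
    simp only [hvF]
    calc ∫ ξ, ‖R 0 (𝓕 (u 0) ξ)‖ ^ 2
        ≤ ∫ ξ, (r ^ 2)⁻¹ * (C₁ ^ 2 * ‖𝓕 (u n) ξ‖ ^ 2 +
            2 * (M 0 ^ 2 * ‖𝓕 (u 1) ξ‖ ^ 2 + ‖𝓕 (u 0) ξ‖ ^ 2)) := by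
          refine integral_mono_of_nonneg (Eventually.of_forall fun _ => by positivity) ?_
            (Eventually.of_forall fun ξ => norm_resolvent_zero_fourier_sq_le hTsemi hTcont hTbdd
              hres hlap hMpos hMmono hMR hc0 hs₀ hPI hn hη hc hpos ht hr hMr y ξ)
          exact (((hF n).const_mul _).add
            ((((hF 1).const_mul _).add (hF 0)).const_mul _)).const_mul _
      _ = (r ^ 2)⁻¹ * (C₁ ^ 2 * (∫ ξ, ‖𝓕 (u n) ξ‖ ^ 2) +
            2 * (M 0 ^ 2 * (∫ ξ, ‖𝓕 (u 1) ξ‖ ^ 2) + ∫ ξ, ‖𝓕 (u 0) ξ‖ ^ 2)) := by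
          have h10 : Integrable fun ξ =>
              2 * (M 0 ^ 2 * ‖𝓕 (u 1) ξ‖ ^ 2 + ‖𝓕 (u 0) ξ‖ ^ 2) :=
            (((hF 1).const_mul _).add (hF 0)).const_mul _
          rw [integral_const_mul, integral_add ((hF n).const_mul _) h10, integral_const_mul,
            integral_const_mul, integral_add ((hF 1).const_mul _) (hF 0), integral_const_mul]
      _ ≤ (r ^ 2)⁻¹ * (C₁ ^ 2 * (t * (K * ‖y‖) ^ 2 * I n) +
            2 * (M 0 ^ 2 * (t * (K * ‖y‖) ^ 2 * I 1) + t * (K * ‖y‖) ^ 2 * I 0)) := by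
          gcongr <;> exact hFle _
      _ = _ := by rw [hD]; ring
  have hcomm : ∀ τ, 0 ≤ τ → ∀ x, T τ (R 0 x) = R 0 (T τ x) := fun τ hτ x =>
    semigroup_comm_resolvent hTsemi hTcont hTbdd hres hlap le_rfl hτ x
  have hpt : ∀ τ ∈ Icc (t / 2) t, ‖T t (R 0 y)‖ ^ 2 ≤ K ^ 2 * ‖R 0 (u 0 τ)‖ ^ 2 := by
    intro τ hτ
    have hτ0 : 0 ≤ τ := by linarith [hτ.1]
    have h1 : u 0 τ = T τ y := by
      simp only [hu, truncatedOrbit, iteratedDeriv_zero]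
      rw [hone, one_smul]
      constructor
      · rw [le_div_iff₀ ht0]; linarith [hτ.1]
      · rw [div_le_one ht0]; exact hτ.2
    have h2 : T t (R 0 y) = T (t - τ) (R 0 (T τ y)) := by
      have h3 := congrArg (fun A => A (R 0 y)) (hTsemi (t - τ) τ (by linarith [hτ.2]) hτ0)
      rw [← hcomm τ hτ0]
      simpa using h3
    rw [h1, h2, ← mul_pow]
    gcongr
    exact (T (t - τ)).le_of_opNorm_le (hTbdd _) _
  have hvint : Integrable fun τ => K ^ 2 * ‖R 0 (u 0 τ)‖ ^ 2 :=
    ((memLp_two_iff_integrable_sq_norm hvcont.aestronglyMeasurable).1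
      (hvcont.memLp_of_hasCompactSupport hvcs)).const_mul _
  have hlower : t / 2 * ‖T t (R 0 y)‖ ^ 2 ≤ K ^ 2 * ∫ τ, ‖R 0 (u 0 τ)‖ ^ 2 := by
    calc t / 2 * ‖T t (R 0 y)‖ ^ 2 = ∫ _ in Icc (t / 2) t, ‖T t (R 0 y)‖ ^ 2 := by
          rw [setIntegral_const, smul_eq_mul, Real.volume_real_Icc_of_le (by linarith)]
          ring
      _ ≤ ∫ τ in Icc (t / 2) t, K ^ 2 * ‖R 0 (u 0 τ)‖ ^ 2 :=
          setIntegral_mono_on (by simp) hvint.integrableOn measurableSet_Icc hpt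
      _ ≤ ∫ τ, K ^ 2 * ‖R 0 (u 0 τ)‖ ^ 2 :=
          setIntegral_le_integral hvint (Eventually.of_forall fun _ => by positivity)
      _ = _ := integral_const_mul _ _
  have hsq : ‖T t (R 0 y)‖ ^ 2 ≤ (K ^ 2 * √(2 * D) / r * ‖y‖) ^ 2 := by
    have h1 : t / 2 * ‖T t (R 0 y)‖ ^ 2 ≤ K ^ 2 * ((r ^ 2)⁻¹ * (t * (K * ‖y‖) ^ 2 * D)) :=
      hlower.trans (by gcongr)
    have h2 : (K ^ 2 * √(2 * D) / r * ‖y‖) ^ 2 =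
        2 / t * (K ^ 2 * ((r ^ 2)⁻¹ * (t * (K * ‖y‖) ^ 2 * D))) := by
      rw [mul_pow, div_pow, mul_pow, Real.sq_sqrt (by positivity)]
      field_simp
    rw [h2]
    calc ‖T t (R 0 y)‖ ^ 2 = 2 / t * (t / 2 * ‖T t (R 0 y)‖ ^ 2) := by field_simp
      _ ≤ _ := by gcongr
  exact le_of_sq_le_sq hsq (by positivity)
/-- Main quantified decay theorem (Rozendaal–Seifert–Stahn): for a uniformly
bounded `C₀`-semigroup on a Hilbert space whose resolvent exists on `{Re λ ≥ 0}` with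
`‖R(iξ)‖ ≤ M(|ξ|)` for a continuous non-decreasing `M` of positive increase, one has
`‖T(t) R(0)‖ ≤ C / M^{−1}(t)` for all sufficiently large `t` (phrased via: for all `r > 0`
with `M(r) ≤ t`, `‖T(t) R(0)‖ ≤ C / r`). -/
theorem positive_increase_decay_rate
    {X : Type*} [NormedAddCommGroup X] [InnerProductSpace ℂ X] [CompleteSpace X]
    (T : ℝ → (X →L[ℂ] X)) (K : ℝ)
    (hT0 : T 0 = 1)
    (hTsemi : ∀ s t : ℝ, 0 ≤ s → 0 ≤ t → T (s + t) = (T s).comp (T t))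
    (hTcont : ∀ x : X, ContinuousOn (fun t => T t x) (Set.Ici 0))
    (hTbdd : ∀ t : ℝ, 0 ≤ t → ‖T t‖ ≤ K)
    (R : ℂ → (X →L[ℂ] X))
    (hres : ∀ l μ : ℂ, 0 ≤ l.re → 0 ≤ μ.re →
      R l - R μ = (μ - l) • ((R l).comp (R μ)))
    (hlap : ∀ l : ℂ, 0 < l.re → ∀ x : X,
      R l x = ∫ t in Set.Ioi (0:ℝ), Complex.exp (-(l * t)) • T t x)
    (M : ℝ → ℝ) (hMpos : ∀ s : ℝ, 0 ≤ s → 0 < M s)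
    (hMcont : ContinuousOn M (Set.Ici 0))
    (hMmono : ∀ s t : ℝ, 0 ≤ s → s ≤ t → M s ≤ M t)
    (hMR : ∀ ξ : ℝ, ‖R (ξ * Complex.I)‖ ≤ M |ξ|)
    -- M has positive increase:
    (α c s₀ : ℝ) (hα : 0 < α) (hc0 : 0 < c) (hc1 : c ≤ 1) (hs₀ : 0 < s₀)
    (hPI : ∀ l s : ℝ, 1 ≤ l → s₀ ≤ s → c * l ^ α * M s ≤ M (l * s)) :
    ∃ C : ℝ, 0 ≤ C ∧ ∃ t₀ : ℝ, 0 ≤ t₀ ∧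
      ∀ t : ℝ, t₀ ≤ t → ∀ r : ℝ, 0 < r → M r ≤ t →
        ‖(T t).comp (R 0)‖ ≤ C / r := by
  have hK : 0 ≤ K := (norm_nonneg _).trans (hTbdd 0 le_rfl)
  have hM0 := hMpos 0 le_rfl
  have hR0 : ‖R 0‖ ≤ M 0 := by simpa using hMR 0
  obtain ⟨C, hC, hdecay⟩ := norm_comp_resolvent_zero_le_div (T := fun t => T (max t 0)) (K := K)
    (fun s t hs ht => by
      rw [max_eq_left hs, max_eq_left ht, max_eq_left (add_nonneg hs ht), hTsemi s t hs ht])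
    (fun x => (hTcont x).comp_continuous (continuous_id.max continuous_const)
      fun t => le_max_right t 0)
    (fun t => hTbdd _ (le_max_right t 0)) hres
    (fun l hl x => by
      rw [hlap l hl x]
      refine setIntegral_congr_fun measurableSet_Ioi fun t ht => ?_
      simp only [max_eq_left (le_of_lt (mem_Ioi.1 ht))])
    hMpos hMmono hMR hα hc0 hs₀ hPI
  refine ⟨C + K * M 0 * s₀, by positivity, 1, zero_le_one, fun t ht r hr hMr => ?_⟩
  rw [add_div]
  rcases le_total s₀ r with h | h
  · have := hdecay t ht r h hMr
    simp only [max_eq_left (zero_le_one.trans ht)] at this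
    exact this.trans (le_add_of_nonneg_right (by positivity))
  · have h1 : ‖(T t).comp (R 0)‖ ≤ K * M 0 :=
      (ContinuousLinearMap.opNorm_comp_le _ _).trans
        (mul_le_mul (hTbdd t (zero_le_one.trans ht)) hR0 (norm_nonneg _) hK)
    have h2 : K * M 0 ≤ K * M 0 * s₀ / r := by
      rw [le_div_iff₀ hr]
      gcongr
    exact (h1.trans h2).trans (le_add_of_nonneg_left (by positivity))
end

section
/- Let X be a complex Banach space and T a C₀-semigroup on X with sup_{t ≥ 0} ‖T(t)‖ ≤ K < ∞. Let R : {λ ∈ ℂ : Re λ ≥ 0} → L(X) satisfy the resolvent identity on {Re λ ≥ 0} and the Laplace-transform identity R(λ)x = ∫₀^∞ e^{−λt} T(t)x dt for Re λ > 0. Let M : [0,∞) → (0,∞) be continuous and non-decreasing with ‖R(iξ)‖ ≤ M(|ξ|) for all ξ ∈ ℝ, and define M_log(λ) := M(λ)·(log(1 + M(λ)) + log(1 + λ)) for λ ≥ 0. Then there exist c > 0, C ≥ 0 and t₀ ≥ 0 such that for every t ≥ t₀ and every r > 0 with M_log(r) ≤ c t one has ‖T(t)∘R(0)‖ ≤ C/r.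 (The Batty–Duyckaerts upper bound ‖T(t)A^{−1}‖ ≤ C/M_log^{−1}(ct) for uniformly bounded semigroups on arbitrary Banach spaces.) -/
open MeasureTheory

/-- The integral of `f` along the positively oriented boundary of `[a, b] × [-r, r]`. -/
noncomputable def rectBoundaryIntegral {E : Type*} [NormedAddCommGroup E] [NormedSpace ℂ E]
    (f : ℂ → E) (a b r : ℝ) : E :=
  (∫ x : ℝ in a..b, f (x + (-r : ℝ) * Complex.I)) - (∫ x : ℝ in a..b, f (x + r * Complex.I)) +
    Complex.I • (∫ y : ℝ in (-r)..r, f (b + y * Complex.I)) -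
    Complex.I • (∫ y : ℝ in (-r)..r, f (a + y * Complex.I))

section Contour

variable {E : Type*} [NormedAddCommGroup E]

theorem continuousOn_horizontal {f : ℂ → E} {a b y : ℝ} {s : Set ℂ} (hf : ContinuousOn f s)
    (hs : ∀ x ∈ Set.Icc a b, (x + y * Complex.I : ℂ) ∈ s) :
    ContinuousOn (fun x : ℝ => f (x + y * Complex.I)) (Set.Icc a b) :=
  hf.comp (by fun_prop) hs

theorem continuousOn_vertical {f : ℂ → E} {x c d : ℝ} {s : Set ℂ} (hf : ContinuousOn f s)
    (hs : ∀ y ∈ Set.Icc c d, (x + y * Complex.I : ℂ) ∈ s) :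
    ContinuousOn (fun y : ℝ => f (x + y * Complex.I)) (Set.Icc c d) :=
  hf.comp (by fun_prop) hs

variable [NormedSpace ℂ E]

theorem rectBoundaryIntegral_eq_zero [CompleteSpace E] {f : ℂ → E} {a b r : ℝ} (hab : a ≤ b)
    (hr : 0 ≤ r) (hf : DifferentiableOn ℂ f (Set.Icc a b ×ℂ Set.Icc (-r) r)) :
    rectBoundaryIntegral f a b r = 0 := by
  have := Complex.integral_boundary_rect_eq_zero_of_differentiableOn f ⟨a, -r⟩ ⟨b, r⟩
    (by simpa [Set.uIcc_of_le hab, Set.uIcc_of_le (neg_le_self hr)] using hf)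
  simpa [rectBoundaryIntegral] using this

theorem rectBoundaryIntegral_sub {f g : ℂ → E} {a b r : ℝ} (hab : a ≤ b) (hr : 0 < r)
    (ha : a ≠ 0) (hb : b ≠ 0)
    (hf : ContinuousOn f (Set.Icc a b ×ℂ Set.Icc (-r) r \ {0}))
    (hg : ContinuousOn g (Set.Icc a b ×ℂ Set.Icc (-r) r \ {0})) :
    rectBoundaryIntegral (fun z => f z - g z) a b r =
      rectBoundaryIntegral f a b r - rectBoundaryIntegral g a b r := by
  have h {h : ℂ → E} (hh : ContinuousOn h (Set.Icc a b ×ℂ Set.Icc (-r) r \ {0})) {y : ℝ}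
      (hy : y ∈ Set.Icc (-r) r) (hy0 : y ≠ 0) :
      IntervalIntegrable (fun x : ℝ => h (x + y * Complex.I)) volume a b :=
    (continuousOn_horizontal hh fun x hx =>
      ⟨by simp_all [Complex.mem_reProdIm], by simp [Complex.ext_iff, hy0]⟩).intervalIntegrable_of_Icc
      hab
  have v {h : ℂ → E} (hh : ContinuousOn h (Set.Icc a b ×ℂ Set.Icc (-r) r \ {0})) {x : ℝ}
      (hx : x ∈ Set.Icc a b) (hx0 : x ≠ 0) :
      IntervalIntegrable (fun y : ℝ => h (x + y * Complex.I)) volume (-r) r :=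
    (continuousOn_vertical hh fun y hy =>
      ⟨by simp_all [Complex.mem_reProdIm], by simp [Complex.ext_iff, hx0]⟩).intervalIntegrable_of_Icc
      (by linarith)
  have hr1 : -r ∈ Set.Icc (-r) r := ⟨le_rfl, by linarith⟩
  have hr2 : r ∈ Set.Icc (-r) r := ⟨by linarith, le_rfl⟩
  have ha1 : a ∈ Set.Icc a b := ⟨le_rfl, hab⟩
  have hb1 : b ∈ Set.Icc a b := ⟨hab, le_rfl⟩
  unfold rectBoundaryIntegral
  rw [intervalIntegral.integral_sub (h hf hr1 (by linarith)) (h hg hr1 (by linarith)),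
    intervalIntegral.integral_sub (h hf hr2 hr.ne') (h hg hr2 hr.ne'),
    intervalIntegral.integral_sub (v hf hb1 hb) (v hg hb1 hb),
    intervalIntegral.integral_sub (v hf ha1 ha) (v hg ha1 ha)]
  module

theorem rectBoundaryIntegral_smul_const [CompleteSpace E] (f : ℂ → ℂ) (e : E) (a b r : ℝ) :
    rectBoundaryIntegral (fun z => f z • e) a b r = rectBoundaryIntegral f a b r • e := by
  unfold rectBoundaryIntegral
  simp only [intervalIntegral.integral_smul_const]
  module

theorem one_le_norm_rectBoundaryIntegral_inv {a r : ℝ} (ha : 0 < a) (hr : 0 < r) :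
    1 ≤ ‖rectBoundaryIntegral (fun z : ℂ => z⁻¹) (-a) r r‖ := by
  have him (f : ℝ → ℂ) (hf : Continuous f) (c d : ℝ) :
      (∫ x in c..d, f x).im = ∫ x in c..d, (f x).im :=
    (Complex.imCLM.intervalIntegral_comp_comm (hf.intervalIntegrable c d)).symm
  have hre (f : ℝ → ℂ) (hf : Continuous f) (c d : ℝ) :
      (∫ x in c..d, f x).re = ∫ x in c..d, (f x).re :=
    (Complex.reCLM.intervalIntegral_comp_comm (hf.intervalIntegrable c d)).symm
  have hh (y : ℝ) (hy : y ≠ 0) : Continuous fun x : ℝ => ((x : ℂ) + y * Complex.I)⁻¹ :=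
    Continuous.inv₀ (by fun_prop) fun x => by simp [Complex.ext_iff, hy]
  have hv (x : ℝ) (hx : x ≠ 0) : Continuous fun y : ℝ => ((x : ℂ) + y * Complex.I)⁻¹ :=
    Continuous.inv₀ (by fun_prop) fun x => by simp [Complex.ext_iff, hx]
  refine le_trans ?_ ((le_abs_self _).trans (Complex.abs_im_le_norm _))
  have h1 : 0 ≤ (∫ x : ℝ in (-a)..r, ((x : ℂ) + (-r : ℝ) * Complex.I)⁻¹).im := by
    rw [him _ (hh (-r) (by linarith))]
    refine intervalIntegral.integral_nonneg (by linarith) fun x _ => ?_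
    simp only [Complex.inv_im]
    refine div_nonneg ?_ (Complex.normSq_nonneg _)
    simp [hr.le]
  have h2 : (∫ x : ℝ in (-a)..r, ((x : ℂ) + r * Complex.I)⁻¹).im ≤ 0 := by
    rw [him _ (hh r hr.ne')]
    rw [← neg_nonneg, ← intervalIntegral.integral_neg]
    refine intervalIntegral.integral_nonneg (by linarith) fun x _ => neg_nonneg.2 ?_
    simp only [Complex.inv_im]
    refine div_nonpos_of_nonpos_of_nonneg ?_ (Complex.normSq_nonneg _)
    simp [hr.le]
  have h3 : (∫ y : ℝ in (-r)..r, (((-a : ℝ) : ℂ) + y * Complex.I)⁻¹).re ≤ 0 := by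
    rw [hre _ (hv (-a) (by linarith))]
    rw [← neg_nonneg, ← intervalIntegral.integral_neg]
    refine intervalIntegral.integral_nonneg (by linarith) fun x _ => neg_nonneg.2 ?_
    simp only [Complex.inv_re]
    refine div_nonpos_of_nonpos_of_nonneg ?_ (Complex.normSq_nonneg _)
    simp [ha.le]
  have h4 : 1 ≤ (∫ y : ℝ in (-r)..r, ((r : ℂ) + y * Complex.I)⁻¹).re := by
    rw [hre _ (hv r hr.ne')]
    have hc : (1 : ℝ) = ∫ _ in (-r)..r, 1 / (2 * r) := by
      rw [intervalIntegral.integral_const, smul_eq_mul]; field_simp; norm_num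
    rw [hc]
    refine intervalIntegral.integral_mono_on (by linarith) (by simp)
      ((Complex.continuous_re.comp (hv r hr.ne')).intervalIntegrable _ _) fun y hy => ?_
    have hn : Complex.normSq ((r : ℂ) + y * Complex.I) = r ^ 2 + y ^ 2 :=
      Complex.normSq_add_mul_I r y
    simp only [Complex.inv_re, hn]
    rw [div_le_div_iff₀ (by positivity) (by positivity)]
    have : y ^ 2 ≤ r ^ 2 := by nlinarith [hy.1, hy.2]
    simp
    nlinarith
  simp only [rectBoundaryIntegral, Complex.sub_im, Complex.add_im, smul_eq_mul, Complex.mul_im,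
    Complex.I_re, Complex.I_im, zero_mul, one_mul, zero_add]
  linarith

/-- Cauchy's integral formula at the origin for a rectangle, up to a constant. -/
theorem norm_apply_zero_le_norm_rectBoundaryIntegral [CompleteSpace E] {f : ℂ → E} {a r : ℝ}
    (ha : 0 < a) (hr : 0 < r)
    (hf : DifferentiableOn ℂ f (Set.Icc (-a) r ×ℂ Set.Icc (-r) r)) :
    ‖f 0‖ ≤ ‖rectBoundaryIntegral (fun z => z⁻¹ • f z) (-a) r r‖ := by
  have hn : Set.Icc (-a) r ×ℂ Set.Icc (-r) r ∈ nhds (0 : ℂ) := by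
    refine Filter.inter_mem ?_ ?_
    · exact Complex.continuous_re.continuousAt.preimage_mem_nhds
        (Icc_mem_nhds (by simpa using ha) (by simpa using hr))
    · exact Complex.continuous_im.continuousAt.preimage_mem_nhds
        (Icc_mem_nhds (by simpa using hr) (by simpa using hr))
  have h0 := rectBoundaryIntegral_eq_zero (f := dslope f 0) (a := -a) (b := r) (by linarith) hr.le
    ((Complex.differentiableOn_dslope hn).2 hf)
  have hinv : ContinuousOn (fun z : ℂ => z⁻¹) (Set.Icc (-a) r ×ℂ Set.Icc (-r) r \ {0}) :=
    continuousOn_inv₀.mono fun z hz => hz.2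
  have h1 : rectBoundaryIntegral (dslope f 0) (-a) r r =
      rectBoundaryIntegral (fun z => z⁻¹ • f z - z⁻¹ • f 0) (-a) r r := by
    have key (z : ℂ) (hz : z ≠ 0) : dslope f 0 z = z⁻¹ • f z - z⁻¹ • f 0 := by
      rw [dslope_of_ne _ hz, slope_def_module, sub_zero, smul_sub]
    unfold rectBoundaryIntegral
    congr 1
    · congr 1
      · congr 1 <;> refine intervalIntegral.integral_congr fun x _ => key _ ?_ <;>
          simp [Complex.ext_iff, hr.ne']
      · congr 1
        refine intervalIntegral.integral_congr fun x _ => key _ ?_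
        simp [Complex.ext_iff, hr.ne']
    · congr 1
      refine intervalIntegral.integral_congr fun x _ => key _ ?_
      simp [Complex.ext_iff, ha.ne']
  rw [h1, rectBoundaryIntegral_sub (f := fun z => z⁻¹ • f z) (g := fun z => z⁻¹ • f 0)
    (by linarith) hr (by linarith) hr.ne'
    (hinv.smul (hf.continuousOn.mono Set.sdiff_subset)) (hinv.smul continuousOn_const),
    rectBoundaryIntegral_smul_const, sub_eq_zero] at h0
  rw [h0, norm_smul]
  exact le_mul_of_one_le_left (norm_nonneg _) (one_le_norm_rectBoundaryIntegral_inv ha hr)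

theorem norm_inv_mul_one_add_sq_div_le_of_abs_im_eq {z : ℂ} {r : ℝ} (hr : 0 < r)
    (him : |z.im| = r) (hre : |z.re| ≤ r) :
    ‖z⁻¹ * (1 + z ^ 2 / (r : ℂ) ^ 2)‖ ≤ 3 * |z.re| / r ^ 2 := by
  have hrz : r ≤ ‖z‖ := him ▸ Complex.abs_im_le_norm z
  have hr0 : (r : ℂ) ≠ 0 := by exact_mod_cast hr.ne'
  have hsq : z.im ^ 2 = r ^ 2 := by rw [← him, sq_abs]
  have hw : 1 + z ^ 2 / (r : ℂ) ^ 2 = (z.re : ℂ) * (z.re + 2 * z.im * Complex.I) / (r : ℂ) ^ 2 := by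
    have hsq' : (z.im : ℂ) ^ 2 = (r : ℂ) ^ 2 := by exact_mod_cast hsq
    have hz : z ^ 2 = (z.re : ℂ) ^ 2 + 2 * z.re * z.im * Complex.I - (z.im : ℂ) ^ 2 := by
      conv_lhs => rw [← Complex.re_add_im z]
      linear_combination (z.im : ℂ) ^ 2 * Complex.I_sq
    rw [hz, hsq']
    field_simp
    ring
  have hn : ‖(z.re : ℂ) + 2 * z.im * Complex.I‖ ≤ 3 * r := by
    refine (norm_add_le _ _).trans ?_
    simp only [norm_mul, Complex.norm_real, Complex.norm_I, Real.norm_eq_abs, Complex.norm_ofNat,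
      him]
    linarith
  rw [hw, norm_mul, norm_inv, norm_div, norm_mul, norm_pow, Complex.norm_real, Complex.norm_real,
    Real.norm_eq_abs, Real.norm_eq_abs, abs_of_pos hr]
  calc ‖z‖⁻¹ * (|z.re| * ‖(z.re : ℂ) + 2 * z.im * Complex.I‖ / r ^ 2)
      ≤ r⁻¹ * (|z.re| * (3 * r) / r ^ 2) := by gcongr
    _ = 3 * |z.re| / r ^ 2 := by field_simp

theorem norm_inv_mul_one_add_sq_div_le {z : ℂ} {r : ℝ} (hr : 0 < r)
    (him : |z.im| ≤ r) (hre : |z.re| ≤ r) (h0 : z.re ≠ 0) :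
    ‖z⁻¹ * (1 + z ^ 2 / (r : ℂ) ^ 2)‖ ≤ 3 / |z.re| := by
  have hzsq : ‖z‖ ^ 2 ≤ 2 * r ^ 2 := by
    rw [Complex.sq_norm, Complex.normSq_apply]
    nlinarith [sq_le_sq' (neg_le_of_abs_le him) (le_of_abs_le him),
      sq_le_sq' (neg_le_of_abs_le hre) (le_of_abs_le hre)]
  have hw : ‖1 + z ^ 2 / (r : ℂ) ^ 2‖ ≤ 3 := by
    refine (norm_add_le _ _).trans ?_
    rw [norm_one, norm_div, norm_pow, norm_pow, Complex.norm_real, Real.norm_eq_abs, sq_abs]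
    have : ‖z‖ ^ 2 / r ^ 2 ≤ 2 := by rw [div_le_iff₀ (by positivity)]; exact hzsq
    linarith
  have hpos : 0 < |z.re| := abs_pos.2 h0
  rw [norm_mul, norm_inv]
  calc ‖z‖⁻¹ * ‖1 + z ^ 2 / (r : ℂ) ^ 2‖ ≤ |z.re|⁻¹ * 3 := by
        gcongr
        exact Complex.abs_re_le_norm z
    _ = 3 / |z.re| := by ring

/-- Newman's contour estimate: `S` is analytic near the rectangle `[-δ, r] × [-r, r]`, and `G` is
entire. -/
theorem norm_sub_apply_zero_le_of_newman_contour [CompleteSpace E] {S G : ℂ → E}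
    {A B δ r t : ℝ} (hA : 0 ≤ A) (hB : 0 ≤ B) (hδ : 0 < δ) (hδr : δ ≤ r) (ht : 0 ≤ t)
    (hS : DifferentiableOn ℂ S (Set.Icc (-δ) r ×ℂ Set.Icc (-r) r)) (hG : Differentiable ℂ G)
    (hSG : ∀ z : ℂ, 0 < z.re → ‖Complex.exp (z * t) • (S z - G z)‖ ≤ A / |z.re|)
    (hGneg : ∀ z : ℂ, z.re < 0 → ‖Complex.exp (z * t) • G z‖ ≤ A / |z.re|)
    (hSneg : ∀ z : ℂ, -δ ≤ z.re → z.re ≤ 0 → |z.im| ≤ r → ‖S z‖ ≤ B) :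
    ‖S 0 - G 0‖ ≤ (30 * A + 12 * B * δ) / r + 6 * B * r * Real.exp (-(δ * t)) / δ := by
  have hr : 0 < r := hδ.trans_le hδr
  set Q : ℂ → ℂ := fun z => Complex.exp (z * t) * (1 + z ^ 2 / (r : ℂ) ^ 2) with hQ
  have hQd : Differentiable ℂ Q := by fun_prop
  set P : ℂ → ℂ := fun z => z⁻¹ * (1 + z ^ 2 / (r : ℂ) ^ 2) with hP
  have hPQ (z : ℂ) (e : E) : z⁻¹ • Q z • e = P z • Complex.exp (z * t) • e := by
    simp only [hP, hQ, smul_smul]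
    ring_nf
  set W : ℂ → E := fun z => z⁻¹ • Q z • (S z - G z) with hW
  set WS : ℂ → E := fun z => z⁻¹ • Q z • S z with hWS
  set WG : ℂ → E := fun z => z⁻¹ • Q z • G z with hWG
  have hWP (z : ℂ) : W z = P z • Complex.exp (z * t) • (S z - G z) := hPQ z _
  have hWSP (z : ℂ) : WS z = P z • Complex.exp (z * t) • S z := hPQ z _
  have hWGP (z : ℂ) : WG z = P z • Complex.exp (z * t) • G z := hPQ z _
  have hWsub (z : ℂ) : W z = WS z - WG z := by simp only [hW, hWS, hWG, smul_sub]
  have hQ0 : Q 0 = 1 := by simp [hQ]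
  have hcauchy : ‖S 0 - G 0‖ ≤ ‖rectBoundaryIntegral W (-δ) r r‖ := by
    have := norm_apply_zero_le_norm_rectBoundaryIntegral (f := fun z => Q z • (S z - G z)) hδ hr
      (hQd.differentiableOn.smul (hS.sub hG.differentiableOn))
    simpa [hQ0] using this
  have hleft : rectBoundaryIntegral WG (-r) (-δ) r = 0 := by
    refine rectBoundaryIntegral_eq_zero (by linarith) hr.le fun z hz => ?_
    have hz0 : z ≠ 0 := by
      rintro rfl
      have := hz.1.2
      simp at this
      linarith
    exact ((differentiableAt_inv hz0).smul ((hQd z).smul (hG z))).differentiableWithinAt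
  have hexp (z : ℂ) : ‖Complex.exp (z * t)‖ = Real.exp (z.re * t) := by
    rw [Complex.norm_exp]; simp
  have hWSn (z : ℂ) (h1 : -δ ≤ z.re) (h2 : z.re ≤ 0) (h3 : |z.im| ≤ r) :
      ‖WS z‖ ≤ ‖P z‖ * (Real.exp (z.re * t) * B) := by
    rw [hWSP, norm_smul, norm_smul, hexp]
    gcongr
    exact hSneg z h1 h2 h3
  have hWGh (z : ℂ) (h1 : -r ≤ z.re) (h2 : z.re < 0) (h3 : |z.im| = r) :
      ‖WG z‖ ≤ 3 * A / r ^ 2 := by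
    rw [hWGP, norm_smul]
    have hpos : 0 < |z.re| := abs_pos.2 h2.ne
    calc ‖P z‖ * ‖Complex.exp (z * t) • G z‖ ≤ 3 * |z.re| / r ^ 2 * (A / |z.re|) := by
          gcongr
          · exact norm_inv_mul_one_add_sq_div_le_of_abs_im_eq hr h3
              (abs_le.2 ⟨h1, by linarith⟩)
          · exact hGneg z h2
      _ = 3 * A / r ^ 2 := by field_simp
  have hWh (z : ℂ) (h1 : -δ ≤ z.re) (h2 : z.re ≤ r) (h3 : |z.im| = r) :
      ‖W z‖ ≤ 3 * (A + B * δ) / r ^ 2 := by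
    have hPz : ‖P z‖ ≤ 3 * |z.re| / r ^ 2 :=
      norm_inv_mul_one_add_sq_div_le_of_abs_im_eq hr h3 (abs_le.2 ⟨by linarith, h2⟩)
    rcases lt_or_ge 0 z.re with hpos | hneg
    · rw [hWP, norm_smul]
      have hpos' : 0 < |z.re| := abs_pos.2 hpos.ne'
      calc ‖P z‖ * ‖Complex.exp (z * t) • (S z - G z)‖
          ≤ 3 * |z.re| / r ^ 2 * (A / |z.re|) := by
            gcongr
            exact hSG z hpos
        _ = 3 * (A + 0) / r ^ 2 := by field_simp; simp
        _ ≤ 3 * (A + B * δ) / r ^ 2 := by gcongr; positivity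
    · have hS' : ‖WS z‖ ≤ 3 * (B * δ) / r ^ 2 := by
        refine (hWSn z h1 hneg h3.le).trans ?_
        have he : Real.exp (z.re * t) ≤ 1 :=
          Real.exp_le_one_iff.2 (mul_nonpos_of_nonpos_of_nonneg hneg ht)
        have hd : |z.re| ≤ δ := abs_le.2 ⟨h1, by linarith⟩
        calc ‖P z‖ * (Real.exp (z.re * t) * B) ≤ 3 * δ / r ^ 2 * (1 * B) := by
              gcongr
              exact hPz.trans (by gcongr)
          _ = 3 * (B * δ) / r ^ 2 := by ring
      have hG' : ‖WG z‖ ≤ 3 * A / r ^ 2 := by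
        rcases hneg.lt_or_eq with h | h
        · exact hWGh z (by linarith) h h3
        · have hP0 : P z = 0 := by simpa [h] using hPz
          rw [hWGP, hP0, zero_smul, norm_zero]
          positivity
      rw [hWsub]
      refine (norm_sub_le _ _).trans ((add_le_add hS' hG').trans_eq ?_)
      ring
  have hH (y : ℝ) (hy : |y| = r) :
      ‖∫ x : ℝ in (-δ)..r, W (x + y * Complex.I)‖ ≤ 3 * (A + B * δ) / r ^ 2 * (2 * r) := by
    refine (intervalIntegral.norm_integral_le_of_norm_le_const fun x hx => ?_).trans
      (mul_le_mul_of_nonneg_left (b := |r - -δ|) ?_ (by positivity))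
    · rw [Set.uIoc_of_le (by linarith)] at hx
      exact hWh _ (by simpa using hx.1.le) (by simpa using hx.2) (by simpa using hy)
    · rw [abs_of_pos (by linarith)]
      linarith
  have hHG (y : ℝ) (hy : |y| = r) :
      ‖∫ x : ℝ in (-r)..(-δ), WG (x + y * Complex.I)‖ ≤ 3 * A / r ^ 2 * r := by
    refine (intervalIntegral.norm_integral_le_of_norm_le_const fun x hx => ?_).trans
      (mul_le_mul_of_nonneg_left (b := |-δ - -r|) ?_ (by positivity))
    · rw [Set.uIoc_of_le (by linarith)] at hx
      exact hWGh _ (by simpa using hx.1.le) (by simpa using hx.2.trans_lt (by linarith))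
        (by simpa using hy)
    · rw [abs_of_nonneg (by linarith)]
      linarith
  have hVle {f : ℂ → E} {x C : ℝ} (h : ∀ z : ℂ, z.re = x → |z.im| ≤ r → ‖f z‖ ≤ C) :
      ‖∫ y : ℝ in (-r)..r, f (x + y * Complex.I)‖ ≤ C * (2 * r) := by
    refine (intervalIntegral.norm_integral_le_of_norm_le_const fun y hy => ?_).trans_eq
      (congrArg (C * ·) (?_ : |r - -r| = 2 * r))
    · rw [Set.uIoc_of_le (by linarith)] at hy
      exact h _ (by simp) (by simpa using abs_le.2 ⟨hy.1.le, hy.2⟩)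
    · rw [abs_of_nonneg (by linarith)]
      ring
  have hVr : ‖∫ y : ℝ in (-r)..r, W (r + y * Complex.I)‖ ≤ 3 / r * (A / r) * (2 * r) := by
    refine hVle fun z h1 h2 => ?_
    have h1' : |z.re| = r := by rw [h1, abs_of_pos hr]
    rw [hWP, norm_smul, ← h1']
    gcongr
    · exact norm_inv_mul_one_add_sq_div_le hr h2 h1'.le (by rw [h1]; exact hr.ne') |>.trans_eq
        (by rw [h1'])
    · exact hSG z (by rw [h1]; exact hr)
  have hVG : ‖∫ y : ℝ in (-r)..r, WG ((-r : ℝ) + y * Complex.I)‖ ≤ 3 / r * (A / r) * (2 * r) := by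
    refine hVle fun z h1 h2 => ?_
    have h1' : |z.re| = r := by rw [h1, abs_neg, abs_of_pos hr]
    rw [hWGP, norm_smul, ← h1']
    gcongr
    · exact norm_inv_mul_one_add_sq_div_le hr h2 h1'.le (by rw [h1]; linarith) |>.trans_eq
        (by rw [h1'])
    · exact hGneg z (by rw [h1]; linarith)
  have hVS : ‖∫ y : ℝ in (-r)..r, WS ((-δ : ℝ) + y * Complex.I)‖ ≤
      3 / δ * (Real.exp (-(δ * t)) * B) * (2 * r) := by
    refine hVle fun z h1 h2 => ?_
    have h1' : |z.re| = δ := by rw [h1, abs_neg, abs_of_pos hδ]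
    refine (hWSn z h1.ge (by linarith) h2).trans ?_
    rw [h1, neg_mul]
    gcongr
    rw [← h1']
    exact norm_inv_mul_one_add_sq_div_le hr h2 (h1'.trans_le hδr) (by rw [h1]; linarith)
  have hWδ : ∫ y : ℝ in (-r)..r, W ((-δ : ℝ) + y * Complex.I) =
      (∫ y : ℝ in (-r)..r, WS ((-δ : ℝ) + y * Complex.I)) -
        ∫ y : ℝ in (-r)..r, WG ((-δ : ℝ) + y * Complex.I) := by
    have hz (y : ℝ) : (((-δ : ℝ) : ℂ) + y * Complex.I) ≠ 0 := by simp [Complex.ext_iff, hδ.ne']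
    have hQi : ContinuousOn (fun z : ℂ => z⁻¹ • Q z) {0}ᶜ :=
      continuousOn_inv₀.smul hQd.continuous.continuousOn
    rw [← intervalIntegral.integral_sub]
    · simp only [hWsub]
    · refine ContinuousOn.intervalIntegrable_of_Icc (by linarith) (continuousOn_vertical
        (s := Set.Icc (-δ) r ×ℂ Set.Icc (-r) r \ {0}) ?_ fun y hy => ⟨?_, hz y⟩)
      · simp only [hWS, ← smul_assoc]
        exact (hQi.mono fun z hz => hz.2).smul (hS.continuousOn.mono Set.sdiff_subset)
      · simp only [Complex.mem_reProdIm]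
        simp [hy.1, hy.2]
        linarith
    · refine ContinuousOn.intervalIntegrable_of_Icc (by linarith) (continuousOn_vertical
        (s := {0}ᶜ) ?_ fun y hy => hz y)
      simp only [hWG, ← smul_assoc]
      exact hQi.smul hG.continuous.continuousOn
  have hdecomp : rectBoundaryIntegral W (-δ) r r =
      ((∫ x : ℝ in (-δ)..r, W (x + (-r : ℝ) * Complex.I)) -
        ∫ x : ℝ in (-δ)..r, W (x + r * Complex.I)) -
      ((∫ x : ℝ in (-r)..(-δ), WG (x + (-r : ℝ) * Complex.I)) -
        ∫ x : ℝ in (-r)..(-δ), WG (x + r * Complex.I)) +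
      Complex.I • ((∫ y : ℝ in (-r)..r, W (r + y * Complex.I)) +
        ((∫ y : ℝ in (-r)..r, WG ((-r : ℝ) + y * Complex.I)) -
          ∫ y : ℝ in (-r)..r, WS ((-δ : ℝ) + y * Complex.I))) := by
    rw [← sub_zero (rectBoundaryIntegral W (-δ) r r), ← hleft]
    simp only [rectBoundaryIntegral]
    rw [hWδ]
    module
  have hr1 : |(-r)| = r := by rw [abs_neg, abs_of_pos hr]
  have hr2 : |r| = r := abs_of_pos hr
  rw [hdecomp] at hcauchy
  have h1 := (norm_sub_le _ _).trans (add_le_add (hH _ hr1) (hH _ hr2))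
  have h2 := (norm_sub_le _ _).trans (add_le_add (hHG _ hr1) (hHG _ hr2))
  have h3 := (norm_add_le _ _).trans (add_le_add hVr ((norm_sub_le _ _).trans (add_le_add hVG hVS)))
  rw [← one_mul ‖_ + _‖, ← Complex.norm_I, ← norm_smul] at h3
  refine (hcauchy.trans ((norm_add_le _ _).trans
    (add_le_add ((norm_sub_le _ _).trans (add_le_add h1 h2)) h3))).trans_eq ?_
  field_simp
  ring

end Contour

section PseudoResolvent

variable {𝔸 : Type*} [NormedRing 𝔸] [NormedAlgebra ℂ 𝔸] {R : ℂ → 𝔸}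

/-- The extension of a pseudo-resolvent `R` to all `z` for which `1 + z • R 0` is invertible. -/
noncomputable def resolventExtension (R : ℂ → 𝔸) (z : ℂ) : 𝔸 :=
  Ring.inverse (1 + z • R 0) * R 0

theorem isUnit_one_add_smul_of_resolvent_identity
    (hres : ∀ l μ : ℂ, 0 ≤ l.re → 0 ≤ μ.re → R l - R μ = (μ - l) • (R l * R μ))
    {μ : ℂ} (hμ : 0 ≤ μ.re) : IsUnit (1 + μ • R 0) := by
  have h1 := hres 0 μ le_rfl hμ
  have h2 := hres μ 0 hμ le_rfl
  rw [sub_zero] at h1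
  rw [zero_sub] at h2
  refine isUnit_iff_exists.2 ⟨1 - μ • R μ, ?_, ?_⟩
  · have : (1 + μ • R 0) * (1 - μ • R μ) = 1 + μ • ((R 0 - R μ) - μ • (R 0 * R μ)) := by
      simp only [add_mul, mul_sub, one_mul, mul_one, smul_mul_assoc, mul_smul_comm]
      module
    rw [this, h1, sub_self, smul_zero, add_zero]
  · have : (1 - μ • R μ) * (1 + μ • R 0) = 1 - μ • ((R μ - R 0) + μ • (R μ * R 0)) := by
      simp only [sub_mul, mul_add, one_mul, mul_one, smul_mul_assoc, mul_smul_comm]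
      module
    rw [this, h2, neg_smul, neg_add_cancel, smul_zero, sub_zero]

theorem isUnit_one_add_smul_of_norm_smul_lt_one [CompleteSpace 𝔸]
    (hres : ∀ l μ : ℂ, 0 ≤ l.re → 0 ≤ μ.re → R l - R μ = (μ - l) • (R l * R μ))
    {z μ : ℂ} (hμ : 0 ≤ μ.re) (h : ‖(z - μ) • R μ‖ < 1) : IsUnit (1 + z • R 0) := by
  have hu : IsUnit (1 + (z - μ) • R μ) := by
    have := isUnit_one_sub_of_norm_lt_one (x := -((z - μ) • R μ)) (by rwa [norm_neg])
    rwa [sub_neg_eq_add] at this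
  have h1 := hres 0 μ le_rfl hμ
  rw [sub_zero] at h1
  convert (isUnit_one_add_smul_of_resolvent_identity hres hμ).mul hu using 1
  have h2 : R μ + μ • (R 0 * R μ) = R 0 := by rw [← h1]; abel
  have : (1 + μ • R 0) * (1 + (z - μ) • R μ) =
      1 + μ • R 0 + (z - μ) • (R μ + μ • (R 0 * R μ)) := by
    simp only [add_mul, mul_add, one_mul, mul_one, smul_mul_assoc, mul_smul_comm, smul_add]
  rw [this, h2]
  module

theorem resolventExtension_sub
    (hres : ∀ l μ : ℂ, 0 ≤ l.re → 0 ≤ μ.re → R l - R μ = (μ - l) • (R l * R μ))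
    {z μ : ℂ} (hμ : 0 ≤ μ.re) (hz : IsUnit (1 + z • R 0)) :
    resolventExtension R z - R μ = (μ - z) • (resolventExtension R z * R μ) := by
  have h1 := hres 0 μ le_rfl hμ
  rw [sub_zero] at h1
  apply hz.mul_left_cancel
  have hU : (1 + z • R 0) * resolventExtension R z = R 0 :=
    Ring.mul_inverse_cancel_left _ _ hz
  rw [mul_sub, hU, mul_smul_comm, ← mul_assoc, hU, add_mul, one_mul, ← sub_sub, h1,
    smul_mul_assoc]
  module

theorem resolventExtension_eq
    (hres : ∀ l μ : ℂ, 0 ≤ l.re → 0 ≤ μ.re → R l - R μ = (μ - l) • (R l * R μ))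
    {μ : ℂ} (hμ : 0 ≤ μ.re) : resolventExtension R μ = R μ := by
  simpa [sub_eq_zero] using
    resolventExtension_sub hres hμ (isUnit_one_add_smul_of_resolvent_identity hres hμ)

theorem norm_resolventExtension_le [CompleteSpace 𝔸]
    (hres : ∀ l μ : ℂ, 0 ≤ l.re → 0 ≤ μ.re → R l - R μ = (μ - l) • (R l * R μ))
    {z μ : ℂ} (hμ : 0 ≤ μ.re) (h : ‖z - μ‖ * ‖R μ‖ ≤ 1 / 2) :
    ‖resolventExtension R z‖ ≤ 2 * ‖R μ‖ := by
  have hz := isUnit_one_add_smul_of_norm_smul_lt_one hres (z := z) hμ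
    (by rw [norm_smul]; linarith)
  have h1 := resolventExtension_sub hres hμ hz
  have h2 : ‖resolventExtension R z - R μ‖ ≤ 1 / 2 * ‖resolventExtension R z‖ := by
    rw [h1, norm_smul, norm_sub_rev]
    calc ‖z - μ‖ * ‖resolventExtension R z * R μ‖
        ≤ ‖z - μ‖ * (‖resolventExtension R z‖ * ‖R μ‖) := by gcongr; exact norm_mul_le _ _
      _ = ‖z - μ‖ * ‖R μ‖ * ‖resolventExtension R z‖ := by ring
      _ ≤ _ := by gcongr
  have h3 := norm_sub_norm_le (resolventExtension R z) (R μ)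
  linarith

theorem differentiableAt_resolventExtension [CompleteSpace 𝔸] {z : ℂ}
    (hz : IsUnit (1 + z • R 0)) : DifferentiableAt ℂ (resolventExtension R) z := by
  have h : DifferentiableAt ℂ (fun w : ℂ => 1 + w • R 0) z := by fun_prop
  exact ((differentiableAt_inverse (𝕜 := ℂ) hz).comp z h).mul_const _

end PseudoResolvent

theorem differentiable_intervalIntegral_exp_neg_mul_smul {E : Type*} [NormedAddCommGroup E]
    [NormedSpace ℂ E] {f : ℝ → E} {t : ℝ} (ht : 0 ≤ t)
    (hf : ContinuousOn f (Set.Icc 0 t)) :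
    Differentiable ℂ fun z : ℂ => ∫ s in (0 : ℝ)..t, Complex.exp (-(z * s)) • f s := by
  intro z
  have hcont (g : ℝ → ℂ) (hg : Continuous g) :
      IntervalIntegrable (fun s => g s • f s) volume 0 t :=
    (hg.continuousOn.smul hf).intervalIntegrable_of_Icc ht
  have hc (w : ℂ) := hcont (fun s => Complex.exp (-(w * s))) (by fun_prop)
  have hc' := hcont (fun s => Complex.exp (-(z * s)) * (-s)) (by fun_prop)
  refine (intervalIntegral.hasDerivAt_integral_of_dominated_loc_of_deriv_le
    (F' := fun w s => (Complex.exp (-(w * s)) * (-s)) • f s)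
    (bound := fun s => Real.exp ((‖z‖ + 1) * t) * t * ‖f s‖)
    (Metric.ball_mem_nhds z one_pos) (.of_forall fun w => ?_) (hc z) ?_
    (.of_forall fun s hs w hw => ?_) ?_ (.of_forall fun s hs w hw => ?_)).2.differentiableAt
  · rw [Set.uIoc_of_le ht]
    exact (hc w).1.aestronglyMeasurable
  · rw [Set.uIoc_of_le ht]
    exact hc'.1.aestronglyMeasurable
  · rw [Set.uIoc_of_le ht] at hs
    have hw' : ‖w‖ ≤ ‖z‖ + 1 := by
      have := norm_sub_norm_le w z
      have := mem_ball_iff_norm.1 hw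
      linarith
    rw [norm_smul, norm_mul, norm_neg, Complex.norm_real, Real.norm_of_nonneg hs.1.le,
      Complex.norm_exp]
    have he : (-(w * (s : ℂ))).re ≤ (‖z‖ + 1) * t :=
      calc (-(w * (s : ℂ))).re ≤ ‖-(w * (s : ℂ))‖ := Complex.re_le_norm _
        _ = ‖w‖ * s := by
          rw [norm_neg, norm_mul, Complex.norm_real, Real.norm_of_nonneg hs.1.le]
        _ ≤ (‖z‖ + 1) * t := mul_le_mul hw' hs.2 hs.1.le (by positivity)
    have := hs.1.le
    have := hs.2
    gcongr
  · exact (hf.norm.intervalIntegrable_of_Icc ht).const_mul _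
  · have h1 : HasDerivAt (fun w : ℂ => -(w * s)) (-(s : ℂ)) w := by
      simpa using ((hasDerivAt_id w).mul_const (s : ℂ)).fun_neg
    exact h1.cexp.smul_const _

section Semigroup

variable {X : Type*} [NormedAddCommGroup X] [NormedSpace ℂ X] {T : ℝ → (X →L[ℂ] X)} {K : ℝ}

theorem norm_exp_smul_le_of_bounded (hTbdd : ∀ t : ℝ, 0 ≤ t → ‖T t‖ ≤ K) (z : ℂ) (x : X) {s : ℝ}
    (hs : 0 ≤ s) :
    ‖Complex.exp (-(z * s)) • T s x‖ ≤ Real.exp (-z.re * s) * (K * ‖x‖) := by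
  rw [norm_smul, Complex.norm_exp]
  gcongr
  · simp
  · exact (T s).le_of_opNorm_le (hTbdd s hs) x

theorem integrableOn_exp_smul_semigroup
    (hTcont : ∀ x : X, ContinuousOn (fun t => T t x) (Set.Ici 0))
    (hTbdd : ∀ t : ℝ, 0 ≤ t → ‖T t‖ ≤ K) {z : ℂ} (hz : 0 < z.re) (x : X) :
    IntegrableOn (fun s : ℝ => Complex.exp (-(z * s)) • T s x) (Set.Ioi 0) := by
  have hint : IntegrableOn (fun s : ℝ => Real.exp (-z.re * s) * (K * ‖x‖)) (Set.Ioi 0) :=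
    (exp_neg_integrableOn_Ioi 0 hz).mul_const _
  refine Integrable.mono' hint ?_ ?_
  · refine ContinuousOn.aestronglyMeasurable ?_ measurableSet_Ioi
    exact ContinuousOn.smul (by fun_prop) ((hTcont x).mono Set.Ioi_subset_Ici_self)
  · exact (ae_restrict_iff' measurableSet_Ioi).2
      (.of_forall fun s hs => norm_exp_smul_le_of_bounded hTbdd z x (le_of_lt hs))

theorem norm_laplace_semigroup_le
    (hTbdd : ∀ t : ℝ, 0 ≤ t → ‖T t‖ ≤ K) {z : ℂ} (hz : 0 < z.re) (x : X) :
    ‖∫ s in Set.Ioi (0 : ℝ), Complex.exp (-(z * s)) • T s x‖ ≤ K * ‖x‖ / z.re := by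
  have hint : IntegrableOn (fun s : ℝ => Real.exp (-z.re * s) * (K * ‖x‖)) (Set.Ioi 0) :=
    (exp_neg_integrableOn_Ioi 0 hz).mul_const _
  refine (norm_integral_le_of_norm_le hint ((ae_restrict_iff' measurableSet_Ioi).2
    (.of_forall fun s hs => norm_exp_smul_le_of_bounded hTbdd z x (le_of_lt hs)))).trans_eq ?_
  rw [integral_mul_const, integral_exp_mul_Ioi (by linarith)]
  simp
  ring

theorem laplace_semigroup_sub_intervalIntegral [CompleteSpace X]
    (hTsemi : ∀ s t : ℝ, 0 ≤ s → 0 ≤ t → T (s + t) = (T s).comp (T t))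
    (hTcont : ∀ x : X, ContinuousOn (fun t => T t x) (Set.Ici 0))
    (hTbdd : ∀ t : ℝ, 0 ≤ t → ‖T t‖ ≤ K) {z : ℂ} (hz : 0 < z.re) (x : X) {t : ℝ} (ht : 0 ≤ t) :
    Complex.exp (z * t) • ((∫ s in Set.Ioi (0 : ℝ), Complex.exp (-(z * s)) • T s x) -
        ∫ s in (0 : ℝ)..t, Complex.exp (-(z * s)) • T s x) =
      T t (∫ s in Set.Ioi (0 : ℝ), Complex.exp (-(z * s)) • T s x) := by
  have hint := integrableOn_exp_smul_semigroup hTcont hTbdd hz x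
  have h1 := intervalIntegral.integral_Ioi_sub_Ioi hint ht
  have h2 : (∫ s in Set.Ioi t, Complex.exp (-(z * s)) • T s x) =
      ∫ s in Set.Ioi (0 : ℝ), Complex.exp (-(z * (s + t : ℝ))) • T (s + t) x := by
    have := (measurePreserving_add_right volume t).setIntegral_preimage_emb
      (measurableEmbedding_addRight t) (fun s : ℝ => Complex.exp (-(z * s)) • T s x) (Set.Ioi t)
    rw [← this, Set.preimage_add_const_Ioi, sub_self]
  rw [← h1, sub_sub_cancel, h2, ← ContinuousLinearMap.integral_comp_comm _ hint,
    ← integral_smul]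
  refine setIntegral_congr_fun measurableSet_Ioi fun s hs => ?_
  simp only [map_smul, smul_smul]
  rw [add_comm s t, hTsemi t s ht (le_of_lt hs), ContinuousLinearMap.comp_apply, ← Complex.exp_add]
  congr 2
  push_cast
  ring

theorem norm_exp_smul_intervalIntegral_semigroup_le
    (hTbdd : ∀ t : ℝ, 0 ≤ t → ‖T t‖ ≤ K) {z : ℂ} (hz : z.re < 0) (x : X) {t : ℝ} (ht : 0 ≤ t) :
    ‖Complex.exp (z * t) • ∫ s in (0 : ℝ)..t, Complex.exp (-(z * s)) • T s x‖ ≤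
      K * ‖x‖ / |z.re| := by
  have hK : 0 ≤ K := (norm_nonneg _).trans (hTbdd 0 le_rfl)
  have h1 : ‖∫ s in (0 : ℝ)..t, Complex.exp (-(z * s)) • T s x‖ ≤
      ∫ s in (0 : ℝ)..t, Real.exp (-z.re * s) * (K * ‖x‖) := by
    refine intervalIntegral.norm_integral_le_of_norm_le ht (.of_forall fun s hs =>
      norm_exp_smul_le_of_bounded hTbdd z x hs.1.le) (Continuous.intervalIntegrable ?_ _ _)
    fun_prop
  have h2 : ∫ s in (0 : ℝ)..t, Real.exp (-z.re * s) = (Real.exp (-z.re * t) - 1) / -z.re := by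
    rw [intervalIntegral.integral_comp_mul_left (fun u => Real.exp u) (by linarith), integral_exp,
      smul_eq_mul, mul_zero, Real.exp_zero]
    ring
  rw [intervalIntegral.integral_mul_const, h2] at h1
  rw [norm_smul, Complex.norm_exp, abs_of_neg hz]
  have hre : (z * t).re = z.re * t := by simp
  have hpos : 0 < -z.re := by linarith
  rw [hre]
  calc Real.exp (z.re * t) * ‖∫ s in (0 : ℝ)..t, Complex.exp (-(z * s)) • T s x‖
      ≤ Real.exp (z.re * t) * ((Real.exp (-z.re * t) - 1) / -z.re * (K * ‖x‖)) := by gcongr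
    _ ≤ Real.exp (z.re * t) * (Real.exp (-z.re * t) / -z.re * (K * ‖x‖)) := by
        gcongr
        linarith
    _ = Real.exp (z.re * t) * Real.exp (-z.re * t) * (K * ‖x‖ / -z.re) := by ring
    _ = K * ‖x‖ / -z.re := by rw [← Real.exp_add]; simp

end Semigroup

section Decay

variable {X : Type*} [NormedAddCommGroup X] [NormedSpace ℂ X] [CompleteSpace X]
  {T : ℝ → (X →L[ℂ] X)} {K : ℝ} {R : ℂ → (X →L[ℂ] X)}

theorem exp_smul_sub_intervalIntegral_eq
    (hTsemi : ∀ s t : ℝ, 0 ≤ s → 0 ≤ t → T (s + t) = (T s).comp (T t))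
    (hTcont : ∀ x : X, ContinuousOn (fun t => T t x) (Set.Ici 0))
    (hTbdd : ∀ t : ℝ, 0 ≤ t → ‖T t‖ ≤ K)
    (hlap : ∀ l : ℂ, 0 < l.re → ∀ x : X,
      R l x = ∫ t in Set.Ioi (0 : ℝ), Complex.exp (-(l * t)) • T t x)
    {z : ℂ} (hz : 0 < z.re) (x : X) {t : ℝ} (ht : 0 ≤ t) :
    Complex.exp (z * t) • (R z x - ∫ s in (0 : ℝ)..t, Complex.exp (-(z * s)) • T s x) =
      T t (R z x) := by
  rw [hlap z hz x]
  exact laplace_semigroup_sub_intervalIntegral hTsemi hTcont hTbdd hz x ht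

/-- `A⁻¹ (T t - 1) = ∫₀ᵗ T s`, in terms of `R 0 = -A⁻¹`. -/
theorem apply_zero_sub_intervalIntegral_eq
    (hTsemi : ∀ s t : ℝ, 0 ≤ s → 0 ≤ t → T (s + t) = (T s).comp (T t))
    (hTcont : ∀ x : X, ContinuousOn (fun t => T t x) (Set.Ici 0))
    (hTbdd : ∀ t : ℝ, 0 ≤ t → ‖T t‖ ≤ K)
    (hres : ∀ l μ : ℂ, 0 ≤ l.re → 0 ≤ μ.re → R l - R μ = (μ - l) • (R l * R μ))
    (hlap : ∀ l : ℂ, 0 < l.re → ∀ x : X,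
      R l x = ∫ t in Set.Ioi (0 : ℝ), Complex.exp (-(l * t)) • T t x)
    (x : X) {t : ℝ} (ht : 0 ≤ t) :
    R 0 x - (∫ s in (0 : ℝ)..t, Complex.exp (-((0 : ℂ) * s)) • T s x) = T t (R 0 x) := by
  have hG : Continuous fun z : ℂ => ∫ s in (0 : ℝ)..t, Complex.exp (-(z * s)) • T s x :=
    (differentiable_intervalIntegral_exp_neg_mul_smul ht
      ((hTcont x).mono Set.Icc_subset_Ici_self)).continuous
  have hS : ContinuousAt (resolventExtension R) 0 :=
    (differentiableAt_resolventExtension (by simp)).continuousAt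
  have hSx : ContinuousAt (fun z => resolventExtension R z x) 0 := hS.clm_apply continuousAt_const
  have h0 : resolventExtension R 0 = R 0 := resolventExtension_eq hres le_rfl
  have hlim : Filter.Tendsto (fun ε : ℝ => (ε : ℂ)) (nhdsWithin 0 (Set.Ioi 0)) (nhds 0) :=
    (Complex.continuous_ofReal.tendsto' 0 0 (by simp)).mono_left nhdsWithin_le_nhds
  have hl : ContinuousAt (fun z : ℂ => Complex.exp (z * t) • (resolventExtension R z x -
      ∫ s in (0 : ℝ)..t, Complex.exp (-(z * s)) • T s x)) 0 :=
    ContinuousAt.smul (by fun_prop) (hSx.sub hG.continuousAt)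
  have hr : ContinuousAt (fun z : ℂ => T t (resolventExtension R z x)) 0 :=
    (T t).continuous.continuousAt.comp hSx
  have key := tendsto_nhds_unique_of_eventuallyEq (hl.tendsto.comp hlim) (hr.tendsto.comp hlim) ?_
  · simpa [h0] using key
  · filter_upwards [self_mem_nhdsWithin] with ε hε
    have hε' : 0 < (ε : ℂ).re := by simpa using hε
    simp only [Function.comp_apply, resolventExtension_eq hres hε'.le]
    exact exp_smul_sub_intervalIntegral_eq hTsemi hTcont hTbdd hlap hε' x ht

theorem norm_semigroup_comp_resolvent_zero_le
    (hTsemi : ∀ s t : ℝ, 0 ≤ s → 0 ≤ t → T (s + t) = (T s).comp (T t))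
    (hTcont : ∀ x : X, ContinuousOn (fun t => T t x) (Set.Ici 0))
    (hTbdd : ∀ t : ℝ, 0 ≤ t → ‖T t‖ ≤ K)
    (hres : ∀ l μ : ℂ, 0 ≤ l.re → 0 ≤ μ.re → R l - R μ = (μ - l) • (R l * R μ))
    (hlap : ∀ l : ℂ, 0 < l.re → ∀ x : X,
      R l x = ∫ t in Set.Ioi (0 : ℝ), Complex.exp (-(l * t)) • T t x)
    {m r t : ℝ} (hm : 0 < m) (hmr : 1 / (2 * m) ≤ r) (ht : 0 ≤ t)
    (hR : ∀ ξ : ℝ, |ξ| ≤ r → ‖R (ξ * Complex.I)‖ ≤ m) :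
    ‖(T t).comp (R 0)‖ ≤
      (30 * (K ^ 2 + K) + 12) / r + 24 * m ^ 2 * r * Real.exp (-(t / (2 * m))) := by
  have hK : 0 ≤ K := (norm_nonneg _).trans (hTbdd 0 le_rfl)
  have hδ : 0 < 1 / (2 * m) := by positivity
  have hr : 0 < r := hδ.trans_le hmr
  refine ContinuousLinearMap.opNorm_le_bound _ (by positivity) fun x => ?_
  have hsmall {z : ℂ} (h1 : -(1 / (2 * m)) ≤ z.re) (h2 : z.re ≤ 0) (h3 : |z.im| ≤ r) :
      ‖z - z.im * Complex.I‖ * ‖R (z.im * Complex.I)‖ ≤ 1 / 2 := by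
    have : z - z.im * Complex.I = z.re := by simp [Complex.ext_iff]
    rw [this, Complex.norm_real, Real.norm_eq_abs]
    calc |z.re| * ‖R (z.im * Complex.I)‖ ≤ 1 / (2 * m) * m := by
          gcongr
          · exact abs_le.2 ⟨h1, h2.trans hδ.le⟩
          · exact hR _ h3
      _ = 1 / 2 := by field_simp
  have hS : DifferentiableOn ℂ (fun z => resolventExtension R z x)
      (Set.Icc (-(1 / (2 * m))) r ×ℂ Set.Icc (-r) r) := by
    rintro z ⟨hzre, hzim⟩
    have hu : IsUnit (1 + z • R 0) := by
      rcases le_total 0 z.re with h | h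
      · exact isUnit_one_add_smul_of_resolvent_identity hres h
      · refine isUnit_one_add_smul_of_norm_smul_lt_one hres (μ := z.im * Complex.I) (by simp) ?_
        rw [norm_smul]
        linarith [hsmall hzre.1 h (abs_le.2 hzim)]
    exact ((differentiableAt_resolventExtension hu).clm_apply
      (differentiableAt_const x)).differentiableWithinAt
  have key := norm_sub_apply_zero_le_of_newman_contour
    (S := fun z => resolventExtension R z x)
    (G := fun z => ∫ s in (0 : ℝ)..t, Complex.exp (-(z * s)) • T s x)
    (A := (K ^ 2 + K) * ‖x‖) (B := 2 * m * ‖x‖) (by positivity) (by positivity) hδ hmr ht hS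
    (differentiable_intervalIntegral_exp_neg_mul_smul ht
      ((hTcont x).mono Set.Icc_subset_Ici_self))
    (fun z hz => ?_) (fun z hz => ?_) (fun z h1 h2 h3 => ?_)
  · simp only [resolventExtension_eq hres (μ := 0) le_rfl,
      apply_zero_sub_intervalIntegral_eq hTsemi hTcont hTbdd hres hlap x ht] at key
    refine key.trans_eq ?_
    rw [one_div_mul_eq_div]
    field_simp
    ring
  · simp only [resolventExtension_eq hres hz.le,
      exp_smul_sub_intervalIntegral_eq hTsemi hTcont hTbdd hlap hz x ht]
    rw [abs_of_pos hz]
    calc ‖T t (R z x)‖ ≤ K * ‖R z x‖ := (T t).le_of_opNorm_le (hTbdd t ht) _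
      _ ≤ K * (K * ‖x‖ / z.re) := by
          gcongr
          rw [hlap z hz x]
          exact norm_laplace_semigroup_le hTbdd hz x
      _ = (K ^ 2 + 0) * ‖x‖ / z.re := by ring
      _ ≤ (K ^ 2 + K) * ‖x‖ / z.re := by gcongr
  · refine (norm_exp_smul_intervalIntegral_semigroup_le hTbdd hz x ht).trans ?_
    gcongr
    nlinarith
  · refine (resolventExtension R z).le_of_opNorm_le ?_ x
    refine (norm_resolventExtension_le hres (μ := z.im * Complex.I) (by simp)
      (hsmall h1 h2 h3)).trans ?_
    gcongr
    exact hR _ h3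

end Decay

/-- The Batty–Duyckaerts upper bound: for a uniformly bounded
`C₀`-semigroup on a Banach space whose resolvent exists on `{Re λ ≥ 0}` with
`‖R(iξ)‖ ≤ M(|ξ|)`, setting `M_log(λ) = M(λ)(log(1+M(λ)) + log(1+λ))`, there are `c > 0`,
`C ≥ 0`, `t₀ ≥ 0` such that `‖T(t) R(0)‖ ≤ C / M_log^{−1}(ct)` for `t ≥ t₀` (phrased via:
for all `r > 0` with `M_log(r) ≤ c t`, `‖T(t) R(0)‖ ≤ C / r`). -/
theorem batty_duyckaerts_upper_bound
    {X : Type*} [NormedAddCommGroup X] [NormedSpace ℂ X] [CompleteSpace X]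
    (T : ℝ → (X →L[ℂ] X)) (K : ℝ)
    (hT0 : T 0 = 1)
    (hTsemi : ∀ s t : ℝ, 0 ≤ s → 0 ≤ t → T (s + t) = (T s).comp (T t))
    (hTcont : ∀ x : X, ContinuousOn (fun t => T t x) (Set.Ici 0))
    (hTbdd : ∀ t : ℝ, 0 ≤ t → ‖T t‖ ≤ K)
    (R : ℂ → (X →L[ℂ] X))
    (hres : ∀ l μ : ℂ, 0 ≤ l.re → 0 ≤ μ.re →
      R l - R μ = (μ - l) • ((R l).comp (R μ)))
    (hlap : ∀ l : ℂ, 0 < l.re → ∀ x : X,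
      R l x = ∫ t in Set.Ioi (0:ℝ), Complex.exp (-(l * t)) • T t x)
    (M : ℝ → ℝ) (hMpos : ∀ s : ℝ, 0 ≤ s → 0 < M s)
    (hMcont : ContinuousOn M (Set.Ici 0))
    (hMmono : ∀ s t : ℝ, 0 ≤ s → s ≤ t → M s ≤ M t)
    (hMR : ∀ ξ : ℝ, ‖R (ξ * Complex.I)‖ ≤ M |ξ|) :
    ∃ c : ℝ, 0 < c ∧ ∃ C : ℝ, 0 ≤ C ∧ ∃ t₀ : ℝ, 0 ≤ t₀ ∧
      ∀ t : ℝ, t₀ ≤ t → ∀ r : ℝ, 0 < r →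
        M r * (Real.log (1 + M r) + Real.log (1 + r)) ≤ c * t →
        ‖(T t).comp (R 0)‖ ≤ C / r := by
  have hK : 0 ≤ K := (norm_nonneg _).trans (hTbdd 0 le_rfl)
  have hM0 := hMpos 0 le_rfl
  set r₀ : ℝ := 1 / (2 * M 0) with hr₀
  have hr₀pos : 0 < r₀ := by positivity
  refine ⟨1 / 4, by norm_num, max (K * ‖R 0‖ * r₀) (30 * (K ^ 2 + K) + 36),
    le_max_of_le_right (by positivity), 0, le_rfl, fun t ht r hr hlog => ?_⟩
  rcases lt_or_ge r r₀ with hlt | hge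
  · rw [le_div_iff₀ hr]
    refine le_max_of_le_left ?_
    gcongr
    exact (ContinuousLinearMap.opNorm_comp_le _ _).trans (by gcongr; exact hTbdd t ht)
  · have hm := hMpos r hr.le
    have hmr : 1 / (2 * M r) ≤ r := by
      refine le_trans ?_ hge
      rw [hr₀]
      gcongr
      exact hMmono 0 r le_rfl hr.le
    refine (norm_semigroup_comp_resolvent_zero_le hTsemi hTcont hTbdd hres hlap hm hmr ht
      fun ξ hξ => (hMR ξ).trans (hMmono _ _ (abs_nonneg _) hξ)).trans ?_
    have hexp : Real.exp (-(t / (2 * M r))) ≤ (((1 + M r) * (1 + r)) ^ 2)⁻¹ := by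
      rw [Real.exp_neg]
      gcongr
      rw [← Real.exp_log (show 0 < ((1 + M r) * (1 + r)) ^ 2 by positivity), Real.log_pow,
        Real.log_mul (by positivity) (by positivity)]
      gcongr
      rw [le_div_iff₀ (by positivity)]
      push_cast
      linarith
    have hmain : 24 * M r ^ 2 * r * Real.exp (-(t / (2 * M r))) ≤ 24 / r := by
      calc 24 * M r ^ 2 * r * Real.exp (-(t / (2 * M r)))
          ≤ 24 * M r ^ 2 * r * (((1 + M r) * (1 + r)) ^ 2)⁻¹ := by gcongr
        _ ≤ 24 * M r ^ 2 * r * ((M r * r) ^ 2)⁻¹ := by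
            gcongr <;> linarith
        _ = 24 / r := by field_simp
    calc (30 * (K ^ 2 + K) + 12) / r + 24 * M r ^ 2 * r * Real.exp (-(t / (2 * M r)))
        ≤ (30 * (K ^ 2 + K) + 12) / r + 24 / r := by gcongr
      _ = (30 * (K ^ 2 + K) + 36) / r := by ring
      _ ≤ max (K * ‖R 0‖ * r₀) (30 * (K ^ 2 + K) + 36) / r := by
          gcongr
          exact le_max_right _ _
end

section
/- Let X be a complex Hilbert space and T a C₀-semigroup on X with ‖T(t)‖ ≤ K for all t ≥ 0. Let B ∈ L(X) commute with the semigroup, i.e. B∘T(t) = T(t)∘B for all t ≥ 0, and suppose C_B ≥ 0 is such that for every λ ∈ ℂ with Re λ > 0 and every x ∈ X, ‖∫₀^∞ e^{−λt} T(t)(Bx) dt‖ ≤ C_B ‖x‖ (i.e. sup_{Re λ > 0} ‖B R(λ,A)‖ ≤ C_B). Then for every τ > 0: ‖T(τ)∘B‖ ≤ 2 C_B K² / τ. -/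
open MeasureTheory

theorem memLp_two_of_integrable_of_norm_le {X : Type*} [NormedAddCommGroup X]
    {f : ℝ → X} (hf : Integrable f) {M : ℝ} (hM : ∀ t, ‖f t‖ ≤ M) : MemLp f 2 := by
  rw [memLp_two_iff_integrable_sq_norm hf.aestronglyMeasurable]
  refine (hf.norm.const_mul M).mono' (hf.aestronglyMeasurable.norm.pow 2) (.of_forall fun t ↦ ?_)
  rw [Real.norm_of_nonneg (by positivity), sq]
  gcongr
  exact hM t

section Plancherel

open SchwartzMap FourierTransform
open scoped ContDiff

variable {H : Type*} [NormedAddCommGroup H] [InnerProductSpace ℂ H] [CompleteSpace H]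

/-- The `L²` Fourier transform of an integrable, square-integrable function is given by the
Fourier integral. -/
theorem Real.fourier_toLp_ae_eq {f : ℝ → H} (hf : Integrable f) (hf2 : MemLp f 2) :
    (𝓕 (hf2.toLp f) : Lp H 2 (volume : Measure ℝ)) =ᵐ[volume] 𝓕 f := by
  refine ae_eq_of_integral_contDiff_smul_eq
    ((Lp.memLp _).locallyIntegrable (by norm_num))
    (VectorFourier.fourierIntegral_continuous Real.continuous_fourierChar
      (L := innerₗ ℝ) continuous_inner hf).locallyIntegrable ?_
  intro g g_smooth g_cpt
  have hg₁ : HasCompactSupport (Complex.ofRealCLM ∘ g) := g_cpt.comp_left rfl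
  have hg₂ : ContDiff ℝ ∞ (Complex.ofRealCLM ∘ g) := by fun_prop
  let φ : 𝓢(ℝ, ℂ) := hg₁.toSchwartzMap hg₂
  have hφ (x : ℝ) : φ x = (g x : ℂ) := rfl
  calc
    ∫ x, g x • (𝓕 (hf2.toLp f) : Lp H 2 (volume : Measure ℝ)) x
        = Lp.toTemperedDistribution (𝓕 (hf2.toLp f) : Lp H 2 (volume : Measure ℝ)) φ := by
      simp [hφ]
    _ = ∫ x, 𝓕 φ x • f x := by
      rw [← Lp.fourier_toTemperedDistribution_eq, TemperedDistribution.fourier_apply,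
        Lp.toTemperedDistribution_apply]
      refine integral_congr_ae ?_
      filter_upwards [hf2.coeFn_toLp] with x hx
      rw [hx]
    _ = ∫ x, φ x • 𝓕 f x := by
      simp only [SchwartzMap.fourier_coe]
      have := VectorFourier.integral_fourierIntegral_smul_eq_flip (L := innerₗ ℝ)
        (μ := volume) (ν := volume) Real.continuous_fourierChar continuous_inner φ.integrable hf
      rwa [flip_innerₗ] at this
    _ = ∫ x, g x • 𝓕 f x := by simp [hφ]

theorem Real.eLpNorm_fourier_eq {f : ℝ → H} (hf : Integrable f) (hf2 : MemLp f 2) :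
    eLpNorm (𝓕 f) 2 = eLpNorm f 2 := by
  rw [← eLpNorm_congr_ae (Real.fourier_toLp_ae_eq hf hf2), ← eLpNorm_congr_ae hf2.coeFn_toLp,
    ← Lp.enorm_def, ← Lp.enorm_def, ← ofReal_norm, ← ofReal_norm, Lp.norm_fourier_eq]

theorem integral_norm_sq_le_of_norm_fourier_le {f g : ℝ → H} (hf : Integrable f)
    (hf2 : MemLp f 2) (hg : Integrable g) (hg2 : MemLp g 2) {C : ℝ} (hC : 0 ≤ C)
    (h : ∀ ξ, ‖𝓕 g ξ‖ ≤ C * ‖𝓕 f ξ‖) :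
    ∫ t, ‖g t‖ ^ 2 ≤ C ^ 2 * ∫ t, ‖f t‖ ^ 2 := by
  have hle : eLpNorm g 2 ≤ ENNReal.ofReal C * eLpNorm f 2 := by
    rw [← Real.eLpNorm_fourier_eq hf hf2, ← Real.eLpNorm_fourier_eq hg hg2]
    exact eLpNorm_le_mul_eLpNorm_of_ae_le_mul (.of_forall h) 2
  have hnonneg (k : ℝ → H) : 0 ≤ ∫ t, ‖k t‖ ^ 2 := integral_nonneg fun t ↦ by positivity
  have hsqrt {k : ℝ → H} (hk : MemLp k 2) :
      eLpNorm k 2 = ENNReal.ofReal (√(∫ t, ‖k t‖ ^ 2)) := by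
    rw [hk.eLpNorm_eq_integral_rpow_norm (by norm_num) (by norm_num), Real.sqrt_eq_rpow]
    norm_num
  rw [hsqrt hf2, hsqrt hg2, ← ENNReal.ofReal_mul hC,
    ENNReal.ofReal_le_ofReal_iff (by positivity)] at hle
  have := pow_le_pow_left₀ (Real.sqrt_nonneg _) hle 2
  rwa [mul_pow, Real.sq_sqrt (hnonneg g), Real.sq_sqrt (hnonneg f)] at this

end Plancherel

section

variable {E : Type*} [NormedAddCommGroup E] [NormedSpace ℝ E]

theorem volume_real_Ico_sub_inter_Ioi {τ u : ℝ} (hτ : 0 ≤ τ) (hu : 0 < u) :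
    volume.real (Set.Ico (u - τ) u ∩ Set.Ioi 0) = min u τ := by
  rcases le_or_gt u τ with h | h
  · have : Set.Ico (u - τ) u ∩ Set.Ioi 0 = Set.Ioo 0 u := by
      ext t; simp only [Set.mem_inter_iff, Set.mem_Ico, Set.mem_Ioi, Set.mem_Ioo]
      constructor
      · rintro ⟨⟨_, h2⟩, h3⟩; exact ⟨h3, h2⟩
      · rintro ⟨h3, h2⟩; exact ⟨⟨by linarith, h2⟩, h3⟩
    rw [this, Real.volume_real_Ioo_of_le hu.le, min_eq_left h, sub_zero]
  · rw [Set.inter_eq_left.2, Real.volume_real_Ico_of_le (by linarith), min_eq_right h.le]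
    · ring
    · intro t ht
      exact lt_of_lt_of_le (by linarith) ht.1

theorem integral_Ioi_integral_Ioc_add [CompleteSpace E] {φ : ℝ → E}
    (hφ : IntegrableOn φ (Set.Ioi 0)) {τ : ℝ} (hτ : 0 ≤ τ) :
    ∫ t in Set.Ioi 0, ∫ s in Set.Ioc 0 τ, φ (t + s) = ∫ u in Set.Ioi 0, min u τ • φ u := by
  set μ : Measure ℝ := volume.restrict (Set.Ioi 0) with hμ
  let S : Set (ℝ × ℝ) := {p | p.1 < p.2 ∧ p.2 ≤ p.1 + τ}
  have hS : MeasurableSet S :=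
    (measurableSet_lt measurable_fst measurable_snd).inter
      (measurableSet_le measurable_snd (measurable_fst.add_const τ))
  let G : ℝ → ℝ → E := fun t u ↦ S.indicator (fun p ↦ φ p.2) (t, u)
  have hG_left (u : ℝ) : (fun t ↦ G t u) = (Set.Ico (u - τ) u).indicator (fun _ ↦ φ u) := by
    ext t
    have : (t, u) ∈ S ↔ t ∈ Set.Ico (u - τ) u := by
      simp only [S, Set.mem_ofPred_eq, Set.mem_Ico, sub_le_iff_le_add]; tauto
    by_cases h : (t, u) ∈ S
    · simp only [G, Set.indicator_of_mem h, Set.indicator_of_mem (this.1 h)]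
    · simp only [G, Set.indicator_of_notMem h, Set.indicator_of_notMem (mt this.2 h)]
  have hG_right (t : ℝ) : (fun u ↦ G t u) = (Set.Ioc t (t + τ)).indicator φ := by
    ext u
    have : (t, u) ∈ S ↔ u ∈ Set.Ioc t (t + τ) := Iff.rfl
    by_cases h : (t, u) ∈ S
    · simp only [G, Set.indicator_of_mem h, Set.indicator_of_mem (this.1 h)]
    · simp only [G, Set.indicator_of_notMem h, Set.indicator_of_notMem (mt this.2 h)]
  have hμu {u : ℝ} (hu : 0 < u) : μ.real (Set.Ico (u - τ) u) = min u τ := by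
    rw [measureReal_restrict_apply measurableSet_Ico, volume_real_Ico_sub_inter_Ioi hτ hu]
  have hμfin (u : ℝ) : μ (Set.Ico (u - τ) u) ≠ ⊤ :=
    ((Measure.restrict_apply_le _ _).trans_lt measure_Ico_lt_top).ne
  have hmin : AEStronglyMeasurable (fun u : ℝ ↦ min u τ * ‖φ u‖) μ :=
    ((measurable_id.min measurable_const).aestronglyMeasurable).mul hφ.aestronglyMeasurable.norm
  have hG : Integrable (Function.uncurry G) (μ.prod μ) := by
    have hm : AEStronglyMeasurable (Function.uncurry G) (μ.prod μ) :=
      (hφ.aestronglyMeasurable.comp_snd (μ := μ)).indicator hS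
    refine (integrable_prod_iff' hm).2 ⟨.of_forall fun u ↦ ?_, ?_⟩
    · change Integrable (fun t ↦ G t u) μ
      rw [hG_left, integrable_indicator_iff measurableSet_Ico]
      exact integrableOn_const (hμfin u)
    · refine Integrable.congr (f := fun u ↦ min u τ * ‖φ u‖) ?_ ?_
      · refine (hφ.norm.const_mul τ).mono' hmin ?_
        filter_upwards [ae_restrict_mem measurableSet_Ioi] with u hu
        rw [Real.norm_of_nonneg (mul_nonneg (le_min (le_of_lt hu) hτ) (norm_nonneg _))]
        gcongr
        exact min_le_right _ _
      · filter_upwards [ae_restrict_mem measurableSet_Ioi] with u hu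
        have : (fun t ↦ ‖Function.uncurry G (t, u)‖)
            = (Set.Ico (u - τ) u).indicator (fun _ ↦ ‖φ u‖) := by
          ext t
          rw [← norm_indicator_eq_indicator_norm, ← hG_left]
          rfl
        rw [this, integral_indicator measurableSet_Ico, setIntegral_const, hμu hu, smul_eq_mul]
  calc
    ∫ t in Set.Ioi 0, ∫ s in Set.Ioc 0 τ, φ (t + s) = ∫ t, ∫ u, G t u ∂μ ∂μ := by
      refine setIntegral_congr_fun measurableSet_Ioi fun t ht ↦ ?_
      have hIoc : Set.Ioc t (t + τ) ∩ Set.Ioi 0 = Set.Ioc t (t + τ) :=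
        Set.inter_eq_left.2 fun u hu ↦ lt_trans (Set.mem_Ioi.1 ht) hu.1
      rw [hG_right, integral_indicator measurableSet_Ioc, hμ,
        Measure.restrict_restrict measurableSet_Ioc, hIoc,
        ← intervalIntegral.integral_of_le hτ, ← intervalIntegral.integral_of_le (by linarith),
        intervalIntegral.integral_comp_add_left, add_zero]
    _ = ∫ u, ∫ t, G t u ∂μ ∂μ := integral_integral_swap hG
    _ = ∫ u in Set.Ioi 0, min u τ • φ u := by
      refine setIntegral_congr_fun measurableSet_Ioi fun u hu ↦ ?_
      rw [hG_left, integral_indicator measurableSet_Ico, setIntegral_const, hμu hu]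

end

section

variable {X : Type*} [NormedAddCommGroup X] [NormedSpace ℂ X]

theorem Complex.norm_exp_neg_mul_ofReal (l : ℂ) (t : ℝ) :
    ‖Complex.exp (-(l * t))‖ = Real.exp (-l.re * t) := by
  simp [Complex.norm_exp]

theorem integrableOn_Ioi_exp_neg_mul_smul {v : ℝ → X} (hv : ContinuousOn v (Set.Ici 0)) {M : ℝ}
    (hM : ∀ t, 0 ≤ t → ‖v t‖ ≤ M) {l : ℂ} (hl : 0 < l.re) :
    IntegrableOn (fun t : ℝ ↦ Complex.exp (-(l * t)) • v t) (Set.Ioi 0) := by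
  refine ((integrableOn_exp_mul_Ioi (neg_lt_zero.2 hl) 0).mul_const M).mono' ?_ ?_
  · refine ContinuousOn.aestronglyMeasurable ?_ measurableSet_Ioi
    exact (Continuous.continuousOn (by fun_prop)).smul (hv.mono Set.Ioi_subset_Ici_self)
  · filter_upwards [ae_restrict_mem measurableSet_Ioi] with t ht
    rw [norm_smul, Complex.norm_exp_neg_mul_ofReal]
    gcongr
    exact hM t (le_of_lt ht)

theorem laplace_commuting_operator_truncated_laplace [CompleteSpace X]
    {T : ℝ → (X →L[ℂ] X)} {K : ℝ}
    (hTsemi : ∀ s t : ℝ, 0 ≤ s → 0 ≤ t → T (s + t) = (T s).comp (T t))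
    (hTcont : ∀ x : X, ContinuousOn (fun t ↦ T t x) (Set.Ici 0))
    (hTbdd : ∀ t : ℝ, 0 ≤ t → ‖T t‖ ≤ K) {B : X →L[ℂ] X}
    (hBcomm : ∀ t : ℝ, 0 ≤ t → B.comp (T t) = (T t).comp B)
    {l : ℂ} (hl : 0 < l.re) {τ : ℝ} (hτ : 0 ≤ τ) (x : X) :
    ∫ t in Set.Ioi (0 : ℝ), Complex.exp (-(l * t)) •
        T t (B (∫ s in Set.Ioc 0 τ, Complex.exp (-(l * s)) • T s x)) =
      ∫ u in Set.Ioi (0 : ℝ), min u τ • (Complex.exp (-(l * u)) • T u (B x)) := by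
  have hint (y : X) : IntegrableOn (fun t : ℝ ↦ Complex.exp (-(l * t)) • T t y) (Set.Ioi 0) :=
    integrableOn_Ioi_exp_neg_mul_smul (hTcont y) (fun t ht ↦ (T t).le_of_opNorm_le (hTbdd t ht) y)
      hl
  rw [← integral_Ioi_integral_Ioc_add (hint (B x)) hτ]
  refine setIntegral_congr_fun measurableSet_Ioi fun t ht ↦ ?_
  have ht : 0 ≤ t := le_of_lt ht
  have key := (Complex.exp (-(l * t)) • (T t).comp B).integral_comp_comm
    ((hint x).mono_set (s := Set.Ioc 0 τ) Set.Ioc_subset_Ioi_self)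
  refine key.symm.trans (setIntegral_congr_fun measurableSet_Ioc fun s hs ↦ ?_)
  have hs : 0 ≤ s := hs.1.le
  have hBs : B (T s x) = T s (B x) := DFunLike.congr_fun (hBcomm s hs) x
  simp only [smul_apply, ContinuousLinearMap.comp_apply, map_smul, hBs,
    smul_smul, hTsemi t s ht hs, Complex.ofReal_add, ← Complex.exp_add]
  ring_nf

theorem Real.fourier_indicator_exp_neg_mul_smul {S : Set ℝ} (hS : MeasurableSet S) (v : ℝ → X)
    (a ξ : ℝ) :
    FourierTransform.fourier (S.indicator fun t : ℝ ↦ Complex.exp (-(a * t)) • v t) ξ =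
      ∫ t in S, Complex.exp (-((a + 2 * Real.pi * ξ * Complex.I) * t)) • v t := by
  rw [Real.fourier_real_eq_integral_exp_smul, ← integral_indicator hS]
  congr 1 with t
  by_cases ht : t ∈ S
  · simp only [Set.indicator_of_mem ht, smul_smul, ← Complex.exp_add]
    congr 2
    push_cast
    ring
  · simp only [Set.indicator_of_notMem ht, smul_zero]

end

section

variable {X : Type*} [NormedAddCommGroup X] [InnerProductSpace ℂ X] [CompleteSpace X]

theorem integral_norm_sq_commuting_operator_le
    {T : ℝ → (X →L[ℂ] X)} {K : ℝ}
    (hTsemi : ∀ s t : ℝ, 0 ≤ s → 0 ≤ t → T (s + t) = (T s).comp (T t))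
    (hTcont : ∀ x : X, ContinuousOn (fun t ↦ T t x) (Set.Ici 0))
    (hTbdd : ∀ t : ℝ, 0 ≤ t → ‖T t‖ ≤ K) {B : X →L[ℂ] X}
    (hBcomm : ∀ t : ℝ, 0 ≤ t → B.comp (T t) = (T t).comp B)
    {C : ℝ} (hC : 0 ≤ C)
    (hB : ∀ l : ℂ, 0 < l.re → ∀ x : X,
      ‖∫ t in Set.Ioi (0:ℝ), Complex.exp (-(l * t)) • T t (B x)‖ ≤ C * ‖x‖)
    {a : ℝ} (ha : 0 < a) {τ : ℝ} (hτ : 0 ≤ τ) (x : X) :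
    IntegrableOn (fun t ↦ (t * Real.exp (-a * t) * ‖T t (B x)‖) ^ 2) (Set.Ioc 0 τ) ∧
      ∫ t in Set.Ioc 0 τ, (t * Real.exp (-a * t) * ‖T t (B x)‖) ^ 2 ≤
        C ^ 2 * (K ^ 2 * ‖x‖ ^ 2 * τ) := by
  have hK : 0 ≤ K := (norm_nonneg _).trans (hTbdd 0 le_rfl)
  have hT (t : ℝ) (ht : 0 ≤ t) (y : X) : ‖T t y‖ ≤ K * ‖y‖ :=
    (T t).le_of_opNorm_le (hTbdd t ht) y
  have hexp (t : ℝ) (ht : 0 ≤ t) : Real.exp (-a * t) ≤ 1 :=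
    Real.exp_le_one_iff.2 (by nlinarith)
  have hnorm (t : ℝ) : ‖Complex.exp (-(a * t))‖ = Real.exp (-a * t) :=
    Complex.norm_exp_neg_mul_ofReal a t
  have ha' : 0 < (a : ℂ).re := ha
  let w : ℝ → X := fun t ↦ min t τ • T t (B x)
  have hw (t : ℝ) (ht : 0 ≤ t) : ‖w t‖ ≤ τ * (K * ‖B x‖) := by
    rw [norm_smul, Real.norm_of_nonneg (le_min ht hτ)]
    gcongr
    · exact min_le_right _ _
    · exact hT t ht _
  let f : ℝ → X := (Set.Ioc 0 τ).indicator fun t : ℝ ↦ Complex.exp (-(a * t)) • T t x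
  let g : ℝ → X := (Set.Ioi 0).indicator fun t : ℝ ↦ Complex.exp (-(a * t)) • w t
  have hf : Integrable f := (integrable_indicator_iff measurableSet_Ioc).2 <|
    (integrableOn_Ioi_exp_neg_mul_smul (hTcont x) (fun t ht ↦ hT t ht x) ha').mono_set
      Set.Ioc_subset_Ioi_self
  have hg : Integrable g := (integrable_indicator_iff measurableSet_Ioi).2 <|
    integrableOn_Ioi_exp_neg_mul_smul
      ((continuous_id.min continuous_const).continuousOn.smul (hTcont (B x))) hw ha'
  have hf_norm (t : ℝ) : ‖f t‖ ≤ K * ‖x‖ := by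
    by_cases ht : t ∈ Set.Ioc 0 τ
    · simp only [f, Set.indicator_of_mem ht, norm_smul, hnorm]
      exact (mul_le_of_le_one_left (norm_nonneg _) (hexp t ht.1.le)).trans (hT t ht.1.le x)
    · simp only [f, Set.indicator_of_notMem ht, norm_zero]
      positivity
  have hg_norm (t : ℝ) : ‖g t‖ ≤ τ * (K * ‖B x‖) := by
    by_cases ht : t ∈ Set.Ioi 0
    · have ht' : 0 ≤ t := le_of_lt ht
      simp only [g, Set.indicator_of_mem ht, norm_smul, hnorm]
      exact (mul_le_of_le_one_left (norm_nonneg _) (hexp t ht')).trans (hw t ht')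
    · simp only [g, Set.indicator_of_notMem ht, norm_zero]
      positivity
  have hf2 : MemLp f 2 := memLp_two_of_integrable_of_norm_le hf hf_norm
  have hg2 : MemLp g 2 := memLp_two_of_integrable_of_norm_le hg hg_norm
  have hfourier (ξ : ℝ) :
      ‖FourierTransform.fourier g ξ‖ ≤ C * ‖FourierTransform.fourier f ξ‖ := by
    have hl : 0 < (a + 2 * Real.pi * ξ * Complex.I : ℂ).re := by simpa using ha
    rw [Real.fourier_indicator_exp_neg_mul_smul measurableSet_Ioi,
      Real.fourier_indicator_exp_neg_mul_smul measurableSet_Ioc]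
    refine le_trans (le_of_eq ?_) (hB _ hl _)
    rw [laplace_commuting_operator_truncated_laplace hTsemi hTcont hTbdd hBcomm hl hτ]
    simp only [w, smul_comm (min _ τ)]
  have hg_sq (t : ℝ) (ht : t ∈ Set.Ioc 0 τ) :
      ‖g t‖ ^ 2 = (t * Real.exp (-a * t) * ‖T t (B x)‖) ^ 2 := by
    have ht' : t ∈ Set.Ioi 0 := ht.1
    simp only [g, w, Set.indicator_of_mem ht', norm_smul, hnorm, min_eq_left ht.2,
      Real.norm_of_nonneg ht.1.le]
    ring
  have hg2_int : Integrable fun t ↦ ‖g t‖ ^ 2 := hg2.integrable_norm_pow (by norm_num)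
  refine ⟨hg2_int.integrableOn.congr_fun hg_sq measurableSet_Ioc, ?_⟩
  calc
    ∫ t in Set.Ioc 0 τ, (t * Real.exp (-a * t) * ‖T t (B x)‖) ^ 2
        = ∫ t in Set.Ioc 0 τ, ‖g t‖ ^ 2 :=
      (setIntegral_congr_fun measurableSet_Ioc hg_sq).symm
    _ ≤ ∫ t, ‖g t‖ ^ 2 := setIntegral_le_integral hg2_int (.of_forall fun t ↦ by positivity)
    _ ≤ C ^ 2 * ∫ t, ‖f t‖ ^ 2 := integral_norm_sq_le_of_norm_fourier_le hf hf2 hg hg2 hC hfourier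
    _ = C ^ 2 * ∫ t in Set.Ioc 0 τ, ‖f t‖ ^ 2 := by
      rw [setIntegral_eq_integral_of_forall_compl_eq_zero]
      intro t ht
      simp [f, Set.indicator_of_notMem ht]
    _ ≤ C ^ 2 * (K ^ 2 * ‖x‖ ^ 2 * τ) := by
      gcongr
      have := norm_setIntegral_le_of_norm_le_const (μ := volume) (s := Set.Ioc 0 τ)
        (f := fun t ↦ ‖f t‖ ^ 2) (C := K ^ 2 * ‖x‖ ^ 2) measure_Ioc_lt_top fun t _ ↦ by
          rw [Real.norm_of_nonneg (by positivity), ← mul_pow]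
          gcongr
          exact hf_norm t
      rw [Real.volume_real_Ioc_of_le hτ, sub_zero] at this
      exact (le_abs_self _).trans this

end

/-- Quantified decay for a commuting operator with bounded smoothed
resolvent: if `T` is a uniformly bounded `C₀`-semigroup on a Hilbert space, `B` commutes with
the semigroup, and `‖∫₀^∞ e^{−λt} T(t)(Bx) dt‖ ≤ C_B ‖x‖` for all `Re λ > 0`
(i.e. `sup_{Re λ > 0} ‖B R(λ,A)‖ ≤ C_B`), then `‖T(τ) B‖ ≤ 2 C_B K² / τ` for every `τ > 0`. -/
theorem commuting_operator_quantified_decay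
    {X : Type*} [NormedAddCommGroup X] [InnerProductSpace ℂ X] [CompleteSpace X]
    (T : ℝ → (X →L[ℂ] X)) (K : ℝ)
    (hT0 : T 0 = 1)
    (hTsemi : ∀ s t : ℝ, 0 ≤ s → 0 ≤ t → T (s + t) = (T s).comp (T t))
    (hTcont : ∀ x : X, ContinuousOn (fun t => T t x) (Set.Ici 0))
    (hTbdd : ∀ t : ℝ, 0 ≤ t → ‖T t‖ ≤ K)
    (B : X →L[ℂ] X)
    (hBcomm : ∀ t : ℝ, 0 ≤ t → B.comp (T t) = (T t).comp B)
    (C_B : ℝ) (hC_B : 0 ≤ C_B)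
    (hB : ∀ l : ℂ, 0 < l.re → ∀ x : X,
      ‖∫ t in Set.Ioi (0:ℝ), Complex.exp (-(l * t)) • T t (B x)‖ ≤ C_B * ‖x‖) :
    ∀ τ : ℝ, 0 < τ → ‖(T τ).comp B‖ ≤ 2 * C_B * K ^ 2 / τ := by
  intro τ hτ
  have hK : 0 ≤ K := (norm_nonneg _).trans (hTbdd 0 le_rfl)
  refine ContinuousLinearMap.opNorm_le_bound _ (by positivity) fun x ↦ ?_
  set N : ℝ := ‖(T τ).comp B x‖ with hN
  let a : ℝ := Real.log (4 / 3) / (2 * τ)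
  have ha : 0 < a := div_pos (Real.log_pos (by norm_num)) (by positivity)
  have hexp : Real.exp (-a * τ) ^ 2 = 3 / 4 := by
    rw [← Real.exp_nat_mul, show ((2 : ℕ) : ℝ) * (-a * τ) = -Real.log (4 / 3) by
      simp only [a]; push_cast; field_simp, Real.exp_neg, Real.exp_log (by norm_num)]
    norm_num
  obtain ⟨hint, hle⟩ :=
    integral_norm_sq_commuting_operator_le hTsemi hTcont hTbdd hBcomm hC_B hB ha hτ.le x
  have hpoint (t : ℝ) (ht : t ∈ Set.Ioc 0 τ) :
      3 / 4 * N ^ 2 * t ^ 2 ≤ K ^ 2 * (t * Real.exp (-a * t) * ‖T t (B x)‖) ^ 2 := by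
    have hNt : N ≤ K * ‖T t (B x)‖ := by
      have : T τ = (T (τ - t)).comp (T t) := by
        rw [← hTsemi _ _ (sub_nonneg.2 ht.2) ht.1.le, sub_add_cancel]
      rw [hN, this]
      exact (T (τ - t)).le_of_opNorm_le (hTbdd _ (sub_nonneg.2 ht.2)) _
    have hmono : Real.exp (-a * τ) ≤ Real.exp (-a * t) :=
      Real.exp_le_exp.2 (by nlinarith [ht.2])
    calc
      3 / 4 * N ^ 2 * t ^ 2 = Real.exp (-a * τ) ^ 2 * N ^ 2 * t ^ 2 := by rw [hexp]
      _ ≤ Real.exp (-a * t) ^ 2 * (K * ‖T t (B x)‖) ^ 2 * t ^ 2 := by gcongr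
      _ = _ := by ring
  have hlower : 3 / 4 * N ^ 2 * (τ ^ 3 / 3) ≤ K ^ 2 * (C_B ^ 2 * (K ^ 2 * ‖x‖ ^ 2 * τ)) := by
    calc
      3 / 4 * N ^ 2 * (τ ^ 3 / 3) = ∫ t in Set.Ioc 0 τ, 3 / 4 * N ^ 2 * t ^ 2 := by
        rw [integral_const_mul, ← intervalIntegral.integral_of_le hτ.le, integral_pow]
        norm_num
      _ ≤ ∫ t in Set.Ioc 0 τ, K ^ 2 * (t * Real.exp (-a * t) * ‖T t (B x)‖) ^ 2 :=
        setIntegral_mono_on (Continuous.integrableOn_Ioc (by fun_prop)) (hint.const_mul _)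
          measurableSet_Ioc hpoint
      _ ≤ _ := by
        rw [integral_const_mul]
        gcongr
  have hsq : (N * τ) ^ 2 ≤ (2 * C_B * K ^ 2 * ‖x‖) ^ 2 := by
    refine le_of_mul_le_mul_right ?_ hτ
    linarith
  rw [div_mul_eq_mul_div, le_div_iff₀ hτ]
  exact le_of_sq_le_sq hsq (by positivity)
end

section
/- Let a ≥ 0 and let N : [a,∞) → (0,∞) be measurable and regularly varying of index α > 0, i.e. for every λ ≥ 1, N(λ s)/N(s) → λ^α as s → ∞. Then N has positive increase: there exist α' > 0, c ∈ (0,1] and s₀ ≥ max(a, 1) such that N(λ s)/N(s) ≥ c λ^{α'} for all λ ≥ 1 and s ≥ s₀. -/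
open MeasureTheory Filter Topology Set in
/-- If `g (x + u) - g x → 0` for every `u ≥ 0` and `g` is measurable, the increments over `[0, 1]`
are uniformly bounded for large `x`. -/
lemma exists_forall_abs_increment_le_one {g : ℝ → ℝ} (hg : Measurable g)
    (h : ∀ u : ℝ, 0 ≤ u → Tendsto (fun x => g (x + u) - g x) atTop (𝓝 0)) :
    ∃ X : ℝ, ∀ x, X ≤ x → ∀ u ∈ Icc (0 : ℝ) 1, |g (x + u) - g x| ≤ 1 := by
  set φ : ℝ → ℝ := fun t => min 1 |t| with hφ
  have hφ_cont : Continuous φ := by fun_prop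
  have hφ_nonneg (t : ℝ) : 0 ≤ φ t := le_min zero_le_one (abs_nonneg t)
  have hφ_norm (t : ℝ) : ‖φ t‖ ≤ 1 := by
    rw [Real.norm_of_nonneg (hφ_nonneg t)]
    exact min_le_left _ _
  have hφ_sub (r s : ℝ) : φ (r - s) ≤ φ r + φ s := by
    have := abs_sub r s
    have := abs_nonneg r
    have := abs_nonneg s
    simp only [hφ]
    rcases min_cases 1 |r - s| with h1 | h1 <;> rcases min_cases 1 |r| with h2 | h2 <;>
      rcases min_cases 1 |s| with h3 | h3 <;> linarith
  have hmeas (y z : ℝ) : Measurable fun v => φ (g (y + v) - z) :=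
    hφ_cont.measurable.comp ((hg.comp (measurable_const_add y)).sub_const z)
  have hint (y z p q : ℝ) : IntervalIntegrable (fun v => φ (g (y + v) - z)) volume p q :=
    (intervalIntegrable_const (c := (1 : ℝ))).mono_fun (hmeas y z).aestronglyMeasurable
      (ae_of_all _ fun v => by simpa using hφ_norm _)
  have hlim : Tendsto (fun x => ∫ v in (0 : ℝ)..2, φ (g (x + v) - g x)) atTop (𝓝 0) := by
    have := intervalIntegral.tendsto_integral_filter_of_dominated_convergence (μ := volume)
      (a := 0) (b := 2) (l := atTop) (F := fun x v => φ (g (x + v) - g x)) (f := fun _ => 0)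
      (fun _ => 1) (Eventually.of_forall fun x => (hmeas x (g x)).aestronglyMeasurable)
      (Eventually.of_forall fun x => ae_of_all _ fun v _ => hφ_norm _)
      intervalIntegrable_const
      (ae_of_all _ fun v hv => by
        rw [uIoc_of_le zero_le_two] at hv
        simpa [hφ, Function.comp_def] using (hφ_cont.tendsto 0).comp (h v hv.1.le))
    simpa using this
  obtain ⟨X, hX⟩ := eventually_atTop.1 (hlim.eventually_lt_const (by norm_num : (0 : ℝ) < 1 / 4))
  refine ⟨X, fun x hx u hu => ?_⟩
  have hmono (y p q : ℝ) (hp : 0 ≤ p) (hpq : p ≤ q) (hq : q ≤ 2) :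
      ∫ v in p..q, φ (g (y + v) - g y) ≤ ∫ v in (0 : ℝ)..2, φ (g (y + v) - g y) :=
    intervalIntegral.integral_mono_interval hp hpq hq (ae_of_all _ fun v => hφ_nonneg _)
      (hint y (g y) 0 2)
  have hshift : ∫ v in (1 : ℝ)..2, φ (g (x + v) - g (x + u)) =
      ∫ v in (1 - u)..(2 - u), φ (g (x + u + v) - g (x + u)) := by
    rw [← intervalIntegral.integral_comp_sub_right
      (fun v => φ (g (x + u + v) - g (x + u))) u]
    simp only [add_add_sub_cancel]
  have hle : ∫ _ in (1 : ℝ)..2, φ (g (x + u) - g x) ≤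
      ∫ v in (1 : ℝ)..2, (φ (g (x + v) - g x) + φ (g (x + v) - g (x + u))) :=
    intervalIntegral.integral_mono_on one_le_two intervalIntegrable_const
      ((hint _ _ _ _).add (hint _ _ _ _)) fun v _ => by
        simpa using hφ_sub (g (x + v) - g x) (g (x + v) - g (x + u))
  rw [intervalIntegral.integral_add (hint _ _ _ _) (hint _ _ _ _), hshift,
    intervalIntegral.integral_const] at hle
  have h1 := hmono x 1 2 zero_le_one one_le_two le_rfl
  have h2 := hmono (x + u) (1 - u) (2 - u) (by linarith [hu.2]) (by linarith) (by linarith [hu.1])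
  have h3 := hX x hx
  have h4 := hX (x + u) (by linarith [hu.1])
  norm_num at hle
  have h5 : φ (g (x + u) - g x) < 1 := by linarith
  exact ((min_lt_iff.1 h5).resolve_left (lt_irrefl _)).le

open Filter Topology in
/-- A measurable function whose increments tend to zero decreases at most at an arbitrarily small
linear rate, up to an additive constant. -/
lemma exists_forall_le_increment {g : ℝ → ℝ} (hg : Measurable g)
    (h : ∀ u : ℝ, 0 ≤ u → Tendsto (fun x => g (x + u) - g x) atTop (𝓝 0))
    {ε : ℝ} (hε : 0 < ε) :
    ∃ X : ℝ, ∀ x, X ≤ x → ∀ u, 0 ≤ u → -1 - ε * u ≤ g (x + u) - g x := by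
  obtain ⟨X, hX⟩ := exists_forall_abs_increment_le_one hg h
  obtain ⟨Y, hY⟩ := eventually_atTop.1
    ((h 1 zero_le_one).eventually_const_lt (neg_lt_zero.2 hε))
  refine ⟨max X Y, fun x hx u hu => ?_⟩
  have hstep (n : ℕ) : -(ε * n) ≤ g (x + n) - g x := by
    induction n with
    | zero => simp
    | succ n ih =>
      have := hY (x + n) (by linarith [le_max_right X Y, n.cast_nonneg (α := ℝ)])
      rw [add_assoc] at this
      push_cast
      linarith
  have hfloor := Nat.floor_le hu
  have hlt := Nat.lt_floor_add_one u
  have hfrac := (abs_le.1 (hX (x + ⌊u⌋₊)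
    (by linarith [le_max_left X Y, (⌊u⌋₊).cast_nonneg (α := ℝ)]) (u - ⌊u⌋₊)
    ⟨by linarith, by linarith⟩)).1
  rw [add_assoc, add_sub_cancel] at hfrac
  have := hstep ⌊u⌋₊
  have := mul_le_mul_of_nonneg_left hfloor hε.le
  linarith


/-- Every measurable function `N : [a,∞) → (0,∞)` that is regularly varying
of index `α > 0` has positive increase: there exist `α' > 0`, `c ∈ (0,1]` and
`s₀ ≥ max(a,1)` such that `N(λs)/N(s) ≥ c λ^{α'}` for all `λ ≥ 1` and `s ≥ s₀`. -/
theorem regularly_varying_positive_increase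
    (a : ℝ) (ha : 0 ≤ a) (N : ℝ → ℝ) (hNmeas : Measurable N)
    (hNpos : ∀ s : ℝ, a ≤ s → 0 < N s)
    (α : ℝ) (hα : 0 < α)
    -- N is regularly varying of index α:
    (hRV : ∀ l : ℝ, 1 ≤ l →
      Filter.Tendsto (fun s => N (l * s) / N s) Filter.atTop (nhds (l ^ α))) :
    ∃ α' : ℝ, 0 < α' ∧ ∃ c : ℝ, 0 < c ∧ c ≤ 1 ∧ ∃ s₀ : ℝ, max a 1 ≤ s₀ ∧
      ∀ l s : ℝ, 1 ≤ l → s₀ ≤ s → c * l ^ α' ≤ N (l * s) / N s := by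
  have hexp {x u : ℝ} (hx : max a 1 ≤ Real.exp x) (hu : 0 ≤ u) :
      0 < N (Real.exp x) ∧ 0 < N (Real.exp (x + u)) := by
    have hax := (le_max_left a 1).trans hx
    exact ⟨hNpos _ hax, hNpos _ (hax.trans (Real.exp_le_exp.2 (by linarith)))⟩
  set g : ℝ → ℝ := fun x => Real.log (N (Real.exp x)) - α * x with hg
  have hg_meas : Measurable g := by fun_prop
  have hg_lim (u : ℝ) (hu : 0 ≤ u) :
      Filter.Tendsto (fun x => g (x + u) - g x) Filter.atTop (nhds 0) := by
    have hlog := (((hRV (Real.exp u) (Real.one_le_exp hu)).comp Real.tendsto_exp_atTop).log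
      (Real.rpow_pos_of_pos (Real.exp_pos u) α).ne').sub_const (α * u)
    rw [Real.log_rpow (Real.exp_pos u), Real.log_exp, sub_self] at hlog
    refine hlog.congr' ?_
    filter_upwards [Real.tendsto_exp_atTop.eventually_ge_atTop (max a 1)] with x hx
    obtain ⟨h1, h2⟩ := hexp hx hu
    simp only [Function.comp_apply, hg]
    rw [← Real.exp_add, add_comm u x, Real.log_div h2.ne' h1.ne']
    ring
  obtain ⟨X, hX⟩ := exists_forall_le_increment hg_meas hg_lim (half_pos hα)
  refine ⟨α / 2, half_pos hα, Real.exp (-1), Real.exp_pos _, Real.exp_le_one_iff.2 (by norm_num),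
    max (max a 1) (Real.exp X), le_max_left _ _, fun l s hl hs => ?_⟩
  have hs1 : max a 1 ≤ s := (le_max_left _ _).trans hs
  have hs0 : 0 < s := zero_lt_one.trans_le ((le_max_right _ _).trans hs1)
  have hl0 : 0 < l := zero_lt_one.trans_le hl
  have hu : 0 ≤ Real.log l := Real.log_nonneg hl
  obtain ⟨h1, h2⟩ := hexp (x := Real.log s) (by rwa [Real.exp_log hs0]) hu
  have hinc := hX (Real.log s) ((Real.le_log_iff_exp_le hs0).2 ((le_max_right _ _).trans hs))
    (Real.log l) hu
  simp only [hg] at hinc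
  rw [Real.exp_add, Real.exp_log hs0, Real.exp_log hl0, mul_comm s l] at hinc h2
  rw [Real.exp_log hs0] at h1
  rw [Real.rpow_def_of_pos hl0, ← Real.exp_add, ← Real.le_log_iff_exp_le (div_pos h2 h1),
    Real.log_div h2.ne' h1.ne']
  linarith
end

section
/- Let n ≥ 1, let m : ℝ^n → ℂ be measurable and essentially bounded, and let 1 ≤ q < p ≤ ∞. Suppose there exists C ≥ 0 such that ‖𝓕⁻¹(m · 𝓕 f)‖_{L^q(ℝ^n)} ≤ C ‖f‖_{L^p(ℝ^n)} for every Schwartz function f : ℝ^n → ℂ. Then m = 0 almost everywhere. (For p > q, the only bounded (L^p, L^q) Fourier multiplier is the zero operator.) -/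
open MeasureTheory FourierTransform SchwartzMap ENNReal

open Filter Topology Finset

section Translates

variable {V F : Type*} [NormedAddCommGroup V] [NormedAddCommGroup F]

/-- For a function vanishing at infinity, a sum of at most `N` translates is small at every point
far from all the centers. -/
lemma exists_norm_sum_translates_le {h : V → F} (hh : Tendsto h (cocompact V) (𝓝 0))
    {ε : ℝ} (hε : 0 < ε) (N : ℕ) :
    ∃ R₀ : ℝ, ∀ (y : ℕ → V) (x : V), ∀ s ⊆ range N, (∀ i ∈ s, R₀ ≤ ‖x - y i‖) →
      ‖∑ i ∈ s, h (x - y i)‖ ≤ ε := by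
  have hN : (0 : ℝ) < N + 1 := by positivity
  have hev : ∀ᶠ z in cocompact V, ‖h z‖ < ε / (N + 1) := by
    simpa using (tendsto_zero_iff_norm_tendsto_zero.1 hh).eventually_lt_const (div_pos hε hN)
  have hev' := Metric.cobounded_le_cocompact hev
  rw [← comap_norm_atTop] at hev'
  obtain ⟨S, hS, hsub⟩ := hev'
  obtain ⟨R₀, hR₀⟩ := mem_atTop_sets.1 hS
  refine ⟨R₀, fun y x s hs hy ↦ ?_⟩
  calc ‖∑ i ∈ s, h (x - y i)‖ ≤ ∑ i ∈ s, ‖h (x - y i)‖ := norm_sum_le _ _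
    _ ≤ ∑ i ∈ s, ε / (N + 1) := sum_le_sum fun i hi ↦ (hsub (hR₀ _ (hy i hi))).le
    _ = #s * (ε / (N + 1)) := by simp
    _ ≤ (N + 1) * (ε / (N + 1)) := by
      gcongr
      have : #s ≤ N := by simpa using card_le_card hs
      exact_mod_cast this.trans (Nat.le_succ N)
    _ = ε := by field_simp

/-- Close to one of the centers of a well separated family, one is far from the others. -/
lemma le_norm_sub_of_separated {y : ℕ → V} {R : ℝ} (hy : ∀ i j, i ≠ j → 2 * R ≤ ‖y i - y j‖)
    {x : V} {j : ℕ} (hx : ‖x - y j‖ < R) {i : ℕ} (hij : i ≠ j) : R ≤ ‖x - y i‖ := by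
  have h1 := hy i j hij
  have h2 : ‖y i - y j‖ ≤ ‖x - y j‖ + ‖x - y i‖ := by
    have := norm_sub_le (x - y j) (x - y i)
    simpa using this
  linarith

/-- A sum of well separated translates of a bounded function vanishing at infinity is bounded
independently of the number of translates. -/
lemma exists_norm_sum_translates_le_of_separated {h : V → F}
    (hh : Tendsto h (cocompact V) (𝓝 0)) {A : ℝ} (hA : ∀ x, ‖h x‖ ≤ A) (N : ℕ) :
    ∃ R₀ : ℝ, ∀ y : ℕ → V, (∀ i j, i ≠ j → 2 * R₀ ≤ ‖y i - y j‖) →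
      ∀ x, ‖∑ i ∈ range N, h (x - y i)‖ ≤ A + 1 := by
  obtain ⟨R₀, hR₀⟩ := exists_norm_sum_translates_le hh one_pos N
  refine ⟨R₀, fun y hy x ↦ ?_⟩
  by_cases hx : ∃ j ∈ range N, ‖x - y j‖ < R₀
  · obtain ⟨j, hj, hxj⟩ := hx
    rw [← add_sum_erase _ _ hj]
    refine (norm_add_le _ _).trans (add_le_add (hA _) (hR₀ y x _ (erase_subset _ _) ?_))
    exact fun i hi ↦ le_norm_sub_of_separated hy hxj (ne_of_mem_erase hi)
  · push Not at hx
    have := hR₀ y x _ subset_rfl hx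
    linarith [(norm_nonneg _).trans (hA 0)]

variable [MeasurableSpace V] [BorelSpace V] (μ : Measure V)

/-- The `L^p` norm of the sum of `N` well separated translates grows at most like `N ^ (1 / p)`. -/
lemma exists_eLpNorm_sum_translates_le [μ.IsAddRightInvariant] {f : V → F}
    (hf0 : Tendsto f (cocompact V) (𝓝 0))
    {A : ℝ} (hA : ∀ x, ‖f x‖ ≤ A) (hf : Integrable f μ) {p : ℝ≥0∞} (hp : 1 ≤ p) :
    ∃ K : ℝ≥0∞, K ≠ ∞ ∧ ∀ N : ℕ, ∃ R₀ : ℝ, ∀ y : ℕ → V,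
      (∀ i j, i ≠ j → 2 * R₀ ≤ ‖y i - y j‖) →
      eLpNorm (fun x ↦ ∑ i ∈ range N, f (x - y i)) p μ ≤ K * (N : ℝ≥0∞) ^ (1 / p.toReal) := by
  rcases eq_or_ne p ∞ with rfl | hp'
  · refine ⟨ENNReal.ofReal (A + 1), by simp, fun N ↦ ?_⟩
    obtain ⟨R₀, hR₀⟩ := exists_norm_sum_translates_le_of_separated hf0 hA N
    refine ⟨R₀, fun y hy ↦ ?_⟩
    simpa using eLpNormEssSup_le_of_ae_bound (μ := μ) (ae_of_all _ (hR₀ y hy))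
  have hp0 : p ≠ 0 := (zero_lt_one.trans_le hp).ne'
  have hp1 : 1 ≤ p.toReal := by simpa using ENNReal.toReal_mono hp' hp
  have hppos : 0 < p.toReal := by linarith
  set M : ℝ≥0∞ := ENNReal.ofReal (A + 1) ^ (p.toReal - 1)
  refine ⟨(M * ∫⁻ x, ‖f x‖ₑ ∂μ) ^ (1 / p.toReal), ?_, fun N ↦ ?_⟩
  · refine ENNReal.rpow_ne_top_of_nonneg (by positivity) (ENNReal.mul_ne_top ?_ hf.2.ne)
    exact ENNReal.rpow_ne_top_of_nonneg (by linarith) (by simp)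
  obtain ⟨R₀, hR₀⟩ := exists_norm_sum_translates_le_of_separated hf0 hA N
  refine ⟨R₀, fun y hy ↦ ?_⟩
  rw [eLpNorm_eq_lintegral_rpow_enorm_toReal hp0 hp',
    ← ENNReal.mul_rpow_of_nonneg _ _ (by positivity)]
  gcongr
  have hle : ∀ x, ‖∑ i ∈ range N, f (x - y i)‖ₑ ≤ ENNReal.ofReal (A + 1) := fun x ↦ by
    rw [← ofReal_norm]
    exact ENNReal.ofReal_le_ofReal (hR₀ y hy x)
  calc ∫⁻ x, ‖∑ i ∈ range N, f (x - y i)‖ₑ ^ p.toReal ∂μ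
      ≤ ∫⁻ x, M * ∑ i ∈ range N, ‖f (x - y i)‖ₑ ∂μ := by
        refine lintegral_mono fun x ↦ ?_
        calc ‖∑ i ∈ range N, f (x - y i)‖ₑ ^ p.toReal
            = ‖∑ i ∈ range N, f (x - y i)‖ₑ ^ (p.toReal - 1) *
              ‖∑ i ∈ range N, f (x - y i)‖ₑ := by
              conv_lhs => rw [← sub_add_cancel p.toReal 1]
              rw [ENNReal.rpow_add_of_nonneg _ _ (by linarith) zero_le_one, ENNReal.rpow_one]
          _ ≤ M * ∑ i ∈ range N, ‖f (x - y i)‖ₑ := by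
              refine mul_le_mul' (ENNReal.rpow_le_rpow (hle x) (by linarith)) ?_
              exact enorm_sum_le _ _
    _ = M * ∑ i ∈ range N, ∫⁻ x, ‖f (x - y i)‖ₑ ∂μ := by
        have hmeas : ∀ i ∈ range N, AEMeasurable (fun x ↦ ‖f (x - y i)‖ₑ) μ := fun i _ ↦
          (hf.comp_sub_right (y i)).aestronglyMeasurable.enorm
        rw [lintegral_const_mul'' _ (Finset.aemeasurable_fun_sum _ hmeas),
          lintegral_finsetSum' _ hmeas]
    _ = M * ∑ i ∈ range N, ∫⁻ x, ‖f x‖ₑ ∂μ := by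
        congr 1
        exact sum_congr rfl fun i _ ↦ lintegral_sub_right_eq_self (fun x ↦ ‖f x‖ₑ) (y i)
    _ = M * (∫⁻ x, ‖f x‖ₑ ∂μ) * N := by simp; ring

/-- The `L^q` norm of the sum of `N` well separated translates grows at least like
`N ^ (1 / q)`. -/
lemma exists_le_eLpNorm_sum_translates [NormedSpace ℝ V] [FiniteDimensional ℝ V]
    [μ.IsAddHaarMeasure] {g : V → F} (hg0 : Tendsto g (cocompact V) (𝓝 0))
    (hg : Continuous g) {x₀ : V} (hx₀ : g x₀ ≠ 0) {q : ℝ≥0∞} (hq : q ≠ 0) (hq' : q ≠ ∞) :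
    ∃ a : ℝ≥0∞, a ≠ 0 ∧ ∀ N : ℕ, ∃ R₀ : ℝ, ∀ y : ℕ → V,
      (∀ i j, i ≠ j → 2 * R₀ ≤ ‖y i - y j‖) →
      a * (N : ℝ≥0∞) ^ (1 / q.toReal) ≤ eLpNorm (fun x ↦ ∑ i ∈ range N, g (x - y i)) q μ := by
  obtain ⟨δ, hδ, hδg⟩ : ∃ δ : ℝ, 0 < δ ∧ 2 * δ < ‖g x₀‖ :=
    ⟨‖g x₀‖ / 3, by positivity, by linarith [norm_pos_iff.2 hx₀]⟩
  obtain ⟨r, hr, hball⟩ : ∃ r > 0, ∀ x ∈ Metric.ball x₀ r, 2 * δ < ‖g x‖ := by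
    have := hg.norm.continuousAt.eventually_const_lt hδg
    simpa [Metric.eventually_nhds_iff_ball] using this
  have hqpos : 0 < q.toReal := ENNReal.toReal_pos hq hq'
  refine ⟨ENNReal.ofReal δ * μ (Metric.ball 0 r) ^ (1 / q.toReal), ?_, fun N ↦ ?_⟩
  · refine mul_ne_zero (by simpa using hδ) ?_
    refine (ENNReal.rpow_pos (Metric.measure_ball_pos μ _ hr) measure_ball_lt_top.ne).ne'
  obtain ⟨R₀, hR₀⟩ := exists_norm_sum_translates_le hg0 hδ N
  refine ⟨max R₀ (‖x₀‖ + r), fun y hy ↦ ?_⟩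
  set R := max R₀ (‖x₀‖ + r) with hR
  have hR1 : R₀ ≤ R := le_max_left _ _
  have hR2 : ‖x₀‖ + r ≤ R := le_max_right _ _
  set U : Set V := ⋃ i ∈ range N, Metric.ball (x₀ + y i) r with hU
  have hUm : MeasurableSet U :=
    Finset.measurableSet_biUnion _ fun _ _ ↦ Metric.isOpen_ball.measurableSet
  have hμU : μ U = N * μ (Metric.ball 0 r) := by
    rw [hU, measure_biUnion_finset]
    · simp [Measure.addHaar_ball_center]
    · intro i _ j _ hij
      refine Metric.ball_disjoint_ball ?_
      rw [dist_add_left, dist_eq_norm]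
      linarith [hy i j hij, norm_nonneg x₀]
    · exact fun _ _ ↦ Metric.isOpen_ball.measurableSet
  have hlow : ∀ x, ‖U.indicator (fun _ ↦ δ) x‖ ≤ ‖∑ i ∈ range N, g (x - y i)‖ := by
    intro x
    by_cases hx : x ∈ U
    swap
    · simp [hx]
    simp only [Set.indicator_of_mem hx, Real.norm_eq_abs, abs_of_pos hδ]
    simp only [hU, Set.mem_iUnion] at hx
    obtain ⟨j, hj, hxj⟩ := hx
    have hxj' : x - y j ∈ Metric.ball x₀ r := by
      rw [mem_ball_iff_norm] at hxj ⊢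
      rwa [sub_sub, add_comm]
    have hnear : ‖x - y j‖ < R := by
      rw [mem_ball_iff_norm] at hxj'
      linarith [norm_le_norm_add_norm_sub' (x - y j) x₀]
    have h1 := hR₀ y x _ (erase_subset j (range N)) fun i hi ↦
      hR1.trans (le_norm_sub_of_separated hy hnear (ne_of_mem_erase hi))
    have h2 := hball _ hxj'
    rw [← add_sum_erase _ _ hj]
    linarith [norm_le_add_norm_add (g (x - y j)) (∑ i ∈ (range N).erase j, g (x - y i))]
  calc ENNReal.ofReal δ * μ (Metric.ball 0 r) ^ (1 / q.toReal) * (N : ℝ≥0∞) ^ (1 / q.toReal)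
      = eLpNorm (U.indicator fun _ ↦ δ) q μ := by
        rw [eLpNorm_indicator_const hUm hq hq', hμU,
          ENNReal.mul_rpow_of_nonneg _ _ (by positivity), Real.enorm_of_nonneg hδ.le]
        ring
    _ ≤ _ := eLpNorm_mono hlow

end Translates

lemma not_forall_mul_natCast_rpow_le {a K : ℝ≥0∞} (ha : a ≠ 0) (hK : K ≠ ∞) {s t : ℝ}
    (hts : t < s) : ¬ ∀ N : ℕ, a * (N : ℝ≥0∞) ^ s ≤ K * (N : ℝ≥0∞) ^ t := by
  intro h
  have hlim : Tendsto (fun N : ℕ ↦ a * (N : ℝ≥0∞) ^ (s - t)) atTop (𝓝 ∞) := by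
    have := ENNReal.Tendsto.const_mul (a := a) ((ENNReal.tendsto_rpow_at_top (sub_pos.2 hts)).comp
      ENNReal.tendsto_nat_nhds_top) (Or.inl ENNReal.top_ne_zero)
    rwa [ENNReal.mul_top ha] at this
  obtain ⟨N, hN, hN1⟩ := ((hlim.eventually_const_lt hK.lt_top).and (eventually_ge_atTop 1)).exists
  have hN0 : (N : ℝ≥0∞) ≠ 0 := by simpa using (Nat.one_le_iff_ne_zero.1 hN1)
  refine hN.not_ge ?_
  rw [ENNReal.rpow_sub _ _ hN0 (by simp), ← mul_div_assoc]
  exact ENNReal.div_le_of_le_mul (h N)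

section Fourier

open scoped RealInnerProductSpace

variable {V : Type*} [NormedAddCommGroup V] [InnerProductSpace ℝ V] [FiniteDimensional ℝ V]
  [MeasurableSpace V] [BorelSpace V]

lemma continuous_fourierInv_of_integrable {h : V → ℂ} (hh : Integrable h) :
    Continuous (𝓕⁻ h) := by
  have : Continuous (𝓕 h) := VectorFourier.fourierIntegral_continuous Real.continuous_fourierChar
    (L := innerₗ V) continuous_inner hh
  have h2 : 𝓕⁻ h = fun x ↦ 𝓕 h (-x) := funext fun x ↦ Real.fourierInv_eq_fourier_neg h x
  rw [h2]
  exact this.comp continuous_neg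

/-- The Riemann-Lebesgue lemma for the inverse Fourier transform. -/
lemma tendsto_fourierInv_cocompact (h : V → ℂ) : Tendsto (𝓕⁻ h) (cocompact V) (𝓝 0) := by
  have h2 : 𝓕⁻ h = fun x ↦ 𝓕 h (-x) := funext fun x ↦ Real.fourierInv_eq_fourier_neg h x
  rw [h2]
  exact (tendsto_integral_exp_inner_smul_cocompact h).comp
    (Homeomorph.neg V).isClosedEmbedding.tendsto_cocompact

lemma fourier_comp_sub_right (f : V → ℂ) (a ξ : V) :
    𝓕 (fun x ↦ f (x - a)) ξ = Real.fourierChar (-⟪a, ξ⟫) • 𝓕 f ξ := by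
  have := congrFun (VectorFourier.fourierIntegral_comp_add_right Real.fourierChar volume (innerₗ V)
    f (-a)) ξ
  simp only [sub_eq_add_neg]
  simpa [Function.comp_def] using! this

/-- A Fourier multiplier maps a sum of translates to the sum of translates. -/
lemma fourierInv_mul_fourier_sum_translates {m : V → ℂ} {f : 𝓢(V, ℂ)}
    (hint : Integrable (fun ξ ↦ m ξ * 𝓕 (⇑f) ξ)) (y : ℕ → V) (N : ℕ) (x : V) :
    𝓕⁻ (fun ξ ↦ m ξ * 𝓕 (⇑(∑ i ∈ range N, f.compSubConstCLM ℂ (y i))) ξ) x =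
      ∑ i ∈ range N, 𝓕⁻ (fun ξ ↦ m ξ * 𝓕 (⇑f) ξ) (x - y i) := by
  simp_rw [Real.fourierInv_eq]
  rw [← integral_finsetSum]
  · congr 1 with ξ
    have hsum : 𝓕 (⇑(∑ i ∈ range N, f.compSubConstCLM ℂ (y i))) ξ =
        ∑ i ∈ range N, Real.fourierChar (-⟪y i, ξ⟫) • 𝓕 (⇑f) ξ := by
      rw [← SchwartzMap.fourier_coe, ← SchwartzMap.fourierTransformCLM_apply (𝕜 := ℂ), map_sum,
        _root_.sum_apply]
      refine sum_congr rfl fun i _ ↦ ?_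
      rw [← fourier_comp_sub_right]
      rfl
    rw [hsum, mul_sum, smul_sum]
    refine sum_congr rfl fun i _ ↦ ?_
    rw [mul_smul_comm, smul_smul, ← AddChar.map_add_eq_mul, inner_sub_right,
      real_inner_comm ξ (y i), sub_eq_add_neg]
  · intro i _
    simpa only [inner_neg_right, neg_neg] using
      (Real.fourierIntegral_convergent_iff (μ := volume) (-(x - y i))).2 hint

end Fourier

/-- For `p > q`, the only bounded `(L^p, L^q)` Fourier multiplier is the
zero operator: if `m` is measurable and essentially bounded and the multiplier with symbol
`m` is bounded from `L^p(ℝ^n)` to `L^q(ℝ^n)` with `1 ≤ q < p ≤ ∞`, then `m = 0` a.e. -/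
theorem multiplier_zero_of_p_gt_q (n : ℕ) (hn : 1 ≤ n)
    (m : EuclideanSpace ℝ (Fin n) → ℂ) (hm : Measurable m)
    (hbdd : ∃ K : ℝ, ∀ᵐ ξ ∂(volume : Measure (EuclideanSpace ℝ (Fin n))), ‖m ξ‖ ≤ K)
    (p q : ℝ≥0∞) (hq1 : 1 ≤ q) (hqp : q < p)
    (C : ℝ) (hC : 0 ≤ C)
    (hmult : ∀ f : SchwartzMap (EuclideanSpace ℝ (Fin n)) ℂ,
      eLpNorm (𝓕⁻ (fun ξ => m ξ * 𝓕 (⇑f) ξ)) q volume ≤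
        ENNReal.ofReal C * eLpNorm (⇑f) p volume) :
    ∀ᵐ ξ ∂(volume : Measure (EuclideanSpace ℝ (Fin n))), m ξ = 0 := by
  obtain ⟨B, hB⟩ := hbdd
  have hp1 : 1 ≤ p := hq1.trans hqp.le
  have hq0 : q ≠ 0 := (zero_lt_one.trans_le hq1).ne'
  have hqtop : q ≠ ∞ := hqp.ne_top
  have hexp : 1 / p.toReal < 1 / q.toReal := by
    have hqpos := ENNReal.toReal_pos hq0 hqtop
    rcases eq_or_ne p ∞ with rfl | hp'
    · simpa using hqpos
    · exact one_div_lt_one_div_of_lt hqpos ((ENNReal.toReal_lt_toReal hqtop hp').2 hqp)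
  have hint : ∀ f : SchwartzMap (EuclideanSpace ℝ (Fin n)) ℂ,
      Integrable (fun ξ ↦ m ξ * 𝓕 (⇑f) ξ) := fun f ↦
    (𝓕 f).integrable.bdd_mul hm.aestronglyMeasurable hB
  have hzero : ∀ (f : SchwartzMap (EuclideanSpace ℝ (Fin n)) ℂ) x,
      𝓕⁻ (fun ξ ↦ m ξ * 𝓕 (⇑f) ξ) x = 0 := by
    intro f x₀
    by_contra hx₀
    obtain ⟨a, ha, hlow⟩ := exists_le_eLpNorm_sum_translates volume
      (tendsto_fourierInv_cocompact _) (continuous_fourierInv_of_integrable (hint f)) hx₀ hq0 hqtop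
    obtain ⟨K, hK, hupp⟩ := exists_eLpNorm_sum_translates_le volume f.tendsto_cocompact
      f.toBoundedContinuousFunction.norm_coe_le_norm f.integrable hp1
    refine not_forall_mul_natCast_rpow_le ha (ENNReal.mul_ne_top ENNReal.ofReal_ne_top hK
      (a := ENNReal.ofReal C)) hexp fun N ↦ ?_
    obtain ⟨R₁, hR₁⟩ := hlow N
    obtain ⟨R₂, hR₂⟩ := hupp N
    set R := max 0 (max R₁ R₂) with hR
    let e : EuclideanSpace ℝ (Fin n) := EuclideanSpace.single ⟨0, hn⟩ 1
    let y : ℕ → EuclideanSpace ℝ (Fin n) := fun i ↦ (i * (2 * R)) • e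
    have hsep : ∀ i j, i ≠ j → 2 * R ≤ ‖y i - y j‖ := by
      intro i j hij
      have hR0 : 0 ≤ R := le_max_left _ _
      have h1 : (1 : ℝ) ≤ |(i : ℝ) - j| := by
        exact_mod_cast Int.one_le_abs (sub_ne_zero.2 (Nat.cast_injective.ne hij))
      have h2 : ‖y i - y j‖ = |(i : ℝ) - j| * (2 * R) := by
        simp only [y, ← sub_smul, ← sub_mul, norm_smul, Real.norm_eq_abs, abs_mul,
          abs_of_nonneg hR0, e]
        simp
      rw [h2]
      nlinarith
    have h₁ := hR₁ y fun i j hij ↦ le_trans (by simp [hR]) (hsep i j hij)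
    have h₂ := hR₂ y fun i j hij ↦ le_trans (by simp [hR]) (hsep i j hij)
    have h₃ := hmult (∑ i ∈ range N, f.compSubConstCLM ℂ (y i))
    rw [funext (fourierInv_mul_fourier_sum_translates (hint f) y N)] at h₃
    have h₄ : ⇑(∑ i ∈ range N, f.compSubConstCLM ℂ (y i)) =
        fun x ↦ ∑ i ∈ range N, f (x - y i) := by
      ext x
      simp [_root_.sum_apply]
    rw [h₄] at h₃
    calc _ ≤ _ := h₁
      _ ≤ _ := h₃
      _ ≤ _ := mul_le_mul_right h₂ _
      _ = _ := (mul_assoc _ _ _).symm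
  have hloc : LocallyIntegrable m (volume : Measure (EuclideanSpace ℝ (Fin n))) :=
    (memLp_top_of_bound hm.aestronglyMeasurable B hB).locallyIntegrable le_top
  refine ae_eq_zero_of_integral_contDiff_smul_eq_zero hloc fun g hg hgs ↦ ?_
  have hgs' : HasCompactSupport fun x ↦ (g x : ℂ) := hgs.comp_left (g := ((↑) : ℝ → ℂ)) (by simp)
  let ψ : SchwartzMap (EuclideanSpace ℝ (Fin n)) ℂ :=
    hgs'.toSchwartzMap (Complex.ofRealCLM.contDiff.comp hg)
  have hψ := hzero (𝓕⁻ ψ) 0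
  rw [← SchwartzMap.fourier_coe, FourierTransform.fourier_fourierInv_eq, Real.fourierInv_eq] at hψ
  rw [← hψ]
  congr 1 with ξ
  have hψg : ψ ξ = g ξ := rfl
  simp [hψg, mul_comm]
end
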